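/- The functions μ satisfy: (a) μ(x + a) = μ(a) for every integral point x ∈ Λ; (b) equivariance under lattice-preserving linear isometries: if g is a linear isometry of W preserving the lattice, then μ(g(a))(ᵗg^{-1} ξ) = μ(a)(ξ); (c) multiplicativity for orthogonal sums: if W = W₁ ⊕ W₂ is an orthogonal direct sum and a_i is an affine cone in W_i (i=1,2), then μ(a₁ + a₂) = μ(a₁)·μ(a₂); (d) if a is a pointed rational affine cone in W whose affine span contains no point of the lattice of W, then μ(a) = 0. -/

import Mathlib

open MeasureTheory Filter Topology Set
open scoped RealInnerProductSpace Pointwise BigOperators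

noncomputable section

/-- the ambient rational vector space: `ℝ^d` with the standard inner product, which is used
to identify `V` with its dual space `V^*`. -/
abbrev Vd (d : ℕ) := EuclideanSpace ℝ (Fin d)

variable {d : ℕ}

/-- the duality pairing `⟨ξ, x⟩` between `V^*` and `V`, realized by the standard inner
product of `ℝ^d`. -/
def pairE {d : ℕ} (ξ x : Vd d) : ℝ := @inner ℝ _ _ ξ x

/-- `Λ` is a lattice of its span: it is generated by finitely many `ℝ`-independent vectors. -/
def IsLatticeSub (Λ : AddSubgroup (Vd d)) : Prop :=
  ∃ (k : ℕ) (v : Fin k → Vd d), LinearIndependent ℝ v ∧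
    Λ = AddSubgroup.closure (Set.range v)

/-- `Λ` is a full-rank lattice in `ℝ^d`. -/
def IsFullLattice (Λ : AddSubgroup (Vd d)) : Prop :=
  IsLatticeSub Λ ∧ Submodule.span ℝ (Λ : Set (Vd d)) = ⊤

/-- `x` is a rational point with respect to the lattice `Λ`. -/
def IsRatPoint (Λ : AddSubgroup (Vd d)) (x : Vd d) : Prop :=
  ∃ q : ℤ, q ≠ 0 ∧ (q : ℝ) • x ∈ Λ

/-- viewing `φ ∈ V` as a linear functional via the standard pairing, it takes integer values
on `Λ`, i.e. it belongs to the dual lattice. -/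
def IsDualIntegral (Λ : AddSubgroup (Vd d)) (φ : Vd d) : Prop :=
  ∀ x ∈ Λ, ∃ n : ℤ, (pairE (φ) (x)) = (n : ℝ)

/-- a rational polyhedron (inside the span of `Λ`): a finite intersection of half-spaces
bounded by rational affine hyperplanes. -/
def IsRatPolyhedron (Λ : AddSubgroup (Vd d)) (P : Set (Vd d)) : Prop :=
  ∃ (n : ℕ) (φ : Fin n → Vd d) (c : Fin n → ℚ),
    (∀ i, IsDualIntegral Λ (φ i)) ∧
    P = {x | x ∈ Submodule.span ℝ (Λ : Set (Vd d)) ∧ ∀ i, (pairE (φ i) x) ≤ (c i : ℝ)}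

/-- the set `P` contains a straight (affine) line. -/
def ContainsLine (P : Set (Vd d)) : Prop :=
  ∃ x u : Vd d, u ≠ 0 ∧ ∀ t : ℝ, x + t • u ∈ P

/-- equality of meromorphic-type functions near `0`: they agree near `0` outside a closed
set with empty interior (the polar set). -/
def MeroEqAt0 (f g : Vd d → ℝ) : Prop :=
  ∃ Z : Set (Vd d), IsClosed Z ∧ interior Z = ∅ ∧
    ∀ᶠ ξ in 𝓝 (0 : Vd d), ξ ∉ Z → f ξ = g ξ

/-- `g` is analytic at `0` and its Taylor coefficients are rational with respect to an
integral basis (i.e. the coefficients take rational values on dual-lattice vectors). -/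
def HasRatSeriesAt0 (Λ : AddSubgroup (Vd d)) (g : Vd d → ℝ) : Prop :=
  ∃ p : FormalMultilinearSeries ℝ (Vd d) ℝ, HasFPowerSeriesAt g p 0 ∧
    ∀ (n : ℕ) (w : Fin n → Vd d), (∀ i, IsDualIntegral Λ (w i)) →
      ∃ q : ℚ, (p n) w = (q : ℝ)

/-- `f` is meromorphic near `0` with rational Taylor coefficients: near `0` it is a quotient
of two analytic functions with rational Taylor coefficients. -/
def RatMeromorphicAt0 (Λ : AddSubgroup (Vd d)) (f : Vd d → ℝ) : Prop :=
  ∃ g h : Vd d → ℝ, HasRatSeriesAt0 Λ g ∧ HasRatSeriesAt0 Λ h ∧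
    (¬ ∀ᶠ ξ in 𝓝 (0 : Vd d), h ξ = 0) ∧
    (∀ᶠ ξ in 𝓝 (0 : Vd d), h ξ ≠ 0 → f ξ * h ξ = g ξ)

/-- `m` is the canonical Lebesgue measure carried by the rational affine subspace `A`,
normalized so that a fundamental parallelepiped of the lattice `Λ ∩ lin(A)` has volume `1`:
it is the image of the standard Lebesgue measure under a `ℤ`-basis parametrization. -/
def IsCanonicalMeasure (Λ : AddSubgroup (Vd d)) (A : Set (Vd d)) (m : Measure (Vd d)) : Prop :=
  ∃ (k : ℕ) (x₀ : Vd d) (v : Fin k → Vd d),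
    x₀ ∈ A ∧ (∀ i, v i ∈ Λ) ∧ LinearIndependent ℝ v ∧
    A = {x | ∃ t : Fin k → ℝ, x = x₀ + ∑ i, t i • v i} ∧
    (∀ y ∈ Λ, y ∈ Submodule.span ℝ (Set.range v) →
      ∃ c : Fin k → ℤ, y = ∑ i, (c i : ℝ) • v i) ∧
    m = Measure.map (fun t : Fin k → ℝ => x₀ + ∑ i, t i • v i) volume

/-- the characterizing properties of the map `I`: it sends rational polyhedra to meromorphic
functions with rational coefficients, vanishes on polyhedra containing lines, and is given by
`∫_P e^{⟨ξ,x⟩} dm_{<P>}(x)` wherever this integral converges. -/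
def IsIMap (Λ : AddSubgroup (Vd d)) (I : Set (Vd d) → Vd d → ℝ) : Prop :=
  (∀ P, IsRatPolyhedron Λ P → RatMeromorphicAt0 Λ (I P)) ∧
  (∀ P, IsRatPolyhedron Λ P → ContainsLine P → ∀ ξ, I P ξ = 0) ∧
  (∀ P, IsRatPolyhedron Λ P → ∀ m : Measure (Vd d),
    IsCanonicalMeasure Λ ((affineSpan ℝ P : AffineSubspace ℝ (Vd d)) : Set (Vd d)) m →
    ∀ ξ : Vd d, IntegrableOn (fun x => Real.exp (pairE (ξ) (x))) P m →
      I P ξ = ∫ x in P, Real.exp (pairE (ξ) (x)) ∂m)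

/-- the characterizing properties of the map `S`: it sends rational polyhedra to meromorphic
functions with rational coefficients, vanishes on polyhedra containing lines, and is given by
`∑_{x ∈ P ∩ Λ} e^{⟨ξ,x⟩}` wherever this sum converges absolutely. -/
def IsSMap (Λ : AddSubgroup (Vd d)) (S : Set (Vd d) → Vd d → ℝ) : Prop :=
  (∀ P, IsRatPolyhedron Λ P → RatMeromorphicAt0 Λ (S P)) ∧
  (∀ P, IsRatPolyhedron Λ P → ContainsLine P → ∀ ξ, S P ξ = 0) ∧
  (∀ P, IsRatPolyhedron Λ P → ∀ ξ : Vd d,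
    Summable (fun x : ↥(P ∩ (Λ : Set (Vd d))) => Real.exp (pairE ξ (x : Vd d))) →
      S P ξ = ∑' x : ↥(P ∩ (Λ : Set (Vd d))), Real.exp (pairE ξ (x : Vd d)))

/-- `F` is a (nonempty, exposed) face of the convex set `P`. -/
def IsFaceOf (P F : Set (Vd d)) : Prop :=
  F.Nonempty ∧ ∃ φ : Vd d, F = {x ∈ P | ∀ y ∈ P, (pairE (φ) (y)) ≤ (pairE (φ) (x))}

/-- `v` is a vertex of `P`. -/
def IsVertexOf (P : Set (Vd d)) (v : Vd d) : Prop := IsFaceOf P {v}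

/-- the cone of feasible directions of `P` along the face `F` (computed at a point of the
relative interior of `F`). -/
def feasibleCone (P F : Set (Vd d)) : Set (Vd d) :=
  {u | ∃ x ∈ intrinsicInterior ℝ F, ∃ ε : ℝ, 0 < ε ∧ ∀ t : ℝ, 0 < t → t ≤ ε → x + t • u ∈ P}

/-- the supporting cone `<F> + c(P,F)` of `P` along its face `F`. -/
def suppCone (P F : Set (Vd d)) : Set (Vd d) :=
  {z | ∃ a ∈ (affineSpan ℝ F : Set (Vd d)), ∃ u ∈ feasibleCone P F, z = a + u}

/-- the recession cone (cone of directions) of a convex set. -/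
def recCone (P : Set (Vd d)) : Set (Vd d) :=
  {u | ∀ x ∈ P, ∀ t : ℝ, 0 ≤ t → x + t • u ∈ P}

/-- a rational affine cone with respect to the lattice `Λ`: a rational translate of a cone
generated by finitely many lattice vectors. -/
def IsRatAffineCone (Λ : AddSubgroup (Vd d)) (a : Set (Vd d)) : Prop :=
  ∃ (s : Vd d) (n : ℕ) (v : Fin n → Vd d), IsRatPoint Λ s ∧ (∀ i, v i ∈ Λ) ∧
    a = {x | ∃ t : Fin n → ℝ, (∀ i, 0 ≤ t i) ∧ x = s + ∑ i, t i • v i}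

/-- a rational (convex polyhedral) cone with vertex at the origin. -/
def IsRatCone (Λ : AddSubgroup (Vd d)) (c : Set (Vd d)) : Prop :=
  ∃ (n : ℕ) (v : Fin n → Vd d), (∀ i, v i ∈ Λ) ∧
    c = {x | ∃ t : Fin n → ℝ, (∀ i, 0 ≤ t i) ∧ x = ∑ i, t i • v i}

/-- `Q` is a rational scalar product: a symmetric positive definite bilinear form taking
rational values on lattice vectors. -/
def IsRatInner (Λ : AddSubgroup (Vd d)) (Q : Vd d →ₗ[ℝ] Vd d →ₗ[ℝ] ℝ) : Prop :=
  (∀ x y, Q x y = Q y x) ∧ (∀ x : Vd d, x ≠ 0 → 0 < Q x x) ∧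
  (∀ x ∈ Λ, ∀ y ∈ Λ, ∃ q : ℚ, Q x y = (q : ℝ))

/-- `π` realizes the quotient map `V → V/L` as the `Q`-orthogonal projection onto the
`Q`-orthogonal complement of `L`. -/
def IsQCoproj (Q : Vd d →ₗ[ℝ] Vd d →ₗ[ℝ] ℝ) (L : Submodule ℝ (Vd d))
    (π : Vd d →ₗ[ℝ] Vd d) : Prop :=
  (∀ x, x - π x ∈ L) ∧ (∀ x : Vd d, ∀ y ∈ L, Q (π x) y = 0)

/-- `Λ'` is the lattice of a rational quotient space of `(V, Λ)`, realized inside `V` via the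
`Q`-orthogonal projection along a rational subspace. -/
def IsQuotLattice (Q : Vd d →ₗ[ℝ] Vd d →ₗ[ℝ] ℝ) (Λ Λ' : AddSubgroup (Vd d)) : Prop :=
  ∃ (L : Submodule ℝ (Vd d)) (π : Vd d →ₗ[ℝ] Vd d),
    Submodule.span ℝ ((L : Set (Vd d)) ∩ (Λ : Set (Vd d))) = L ∧
    IsQCoproj Q L π ∧ Λ' = AddSubgroup.map π.toAddMonoidHom Λ

/-- a family of maps `I` indexed by the rational quotient spaces of `(V,Λ)`, each member
satisfying the characterizing properties of the integral generating function. -/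
def IsIFamily (Q : Vd d →ₗ[ℝ] Vd d →ₗ[ℝ] ℝ) (Λ : AddSubgroup (Vd d))
    (I : AddSubgroup (Vd d) → Set (Vd d) → Vd d → ℝ) : Prop :=
  ∀ Λ', IsQuotLattice Q Λ Λ' → IsIMap Λ' (I Λ')

/-- a family of maps `S` indexed by the rational quotient spaces of `(V,Λ)`, each member
satisfying the characterizing properties of the lattice-point generating function. -/
def IsSFamily (Q : Vd d →ₗ[ℝ] Vd d →ₗ[ℝ] ℝ) (Λ : AddSubgroup (Vd d))
    (S : AddSubgroup (Vd d) → Set (Vd d) → Vd d → ℝ) : Prop :=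
  ∀ Λ', IsQuotLattice Q Λ Λ' → IsSMap Λ' (S Λ')

/-- the defining properties (a),(b),(c) of the family `μ` of Berline--Vergne:
each `μ(a)` is meromorphic with rational coefficients near `0`, `μ_{0}({0}) = 1`, and for
every pointed rational affine cone `a` in a rational quotient `W` of `V` one has
`S(a) = ∑_{f ∈ F(a)} μ(t(a,f)) I(f)`, where the transverse cone `t(a,f)` is realized inside
`V` by the `Q`-orthogonal projection `π F` along `lin(f)`, and functions on quotient duals
are extended by `Q`-orthogonal projection. -/
def IsMuCore (Λ : AddSubgroup (Vd d)) (Q : Vd d →ₗ[ℝ] Vd d →ₗ[ℝ] ℝ)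
    (I S μ : AddSubgroup (Vd d) → Set (Vd d) → Vd d → ℝ) : Prop :=
  (∀ Λ', IsQuotLattice Q Λ Λ' → ∀ a, IsRatAffineCone Λ' a → ¬ ContainsLine a →
      RatMeromorphicAt0 Λ' (μ Λ' a)) ∧
  (∀ ξ, μ ⊥ ({0} : Set (Vd d)) ξ = 1) ∧
  (∀ Λ', IsQuotLattice Q Λ Λ' → ∀ a, IsRatAffineCone Λ' a → ¬ ContainsLine a →
    ∀ π : Set (Vd d) → (Vd d →ₗ[ℝ] Vd d),
      (∀ F, IsFaceOf a F → IsQCoproj Q (affineSpan ℝ F).direction (π F)) →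
      MeroEqAt0 (S Λ' a)
        (fun ξ => ∑ᶠ F ∈ {F | IsFaceOf a F},
          μ (AddSubgroup.map (π F).toAddMonoidHom Λ') ((π F) '' suppCone a F) ξ
            * I Λ' F ξ))

/-- the family `μ`, extended by `μ(a) = 0` on cones containing a straight line. -/
def IsMuFamily (Λ : AddSubgroup (Vd d)) (Q : Vd d →ₗ[ℝ] Vd d →ₗ[ℝ] ℝ)
    (I S μ : AddSubgroup (Vd d) → Set (Vd d) → Vd d → ℝ) : Prop :=
  IsMuCore Λ Q I S μ ∧
  (∀ Λ', IsQuotLattice Q Λ Λ' → ∀ a, IsRatAffineCone Λ' a → ContainsLine a →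
    ∀ ξ, μ Λ' a ξ = 0)

/-- the trace pairing of two `n`-multilinear forms on `ℝ^d`, computed in the standard basis. -/
def multiPair {n : ℕ} (p q : ContinuousMultilinearMap ℝ (fun _ : Fin n => Vd d) ℝ) : ℝ :=
  ∑ ι : Fin n → Fin d,
    p (fun j => (EuclideanSpace.basisFun (Fin d) ℝ) (ι j)) *
    q (fun j => (EuclideanSpace.basisFun (Fin d) ℝ) (ι j))

/-- the action on `h` of the infinite-order constant-coefficient differential operator whose
symbol has Taylor series `p` at `0`; on polynomials `h` the sum is finite.  Its defining
property is `D(Φ)e^{⟨ξ,·⟩} = Φ(ξ)e^{⟨ξ,·⟩}`. -/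
def DOp (p : FormalMultilinearSeries ℝ (Vd d) ℝ) (h : Vd d → ℝ) (x : Vd d) : ℝ :=
  ∑ᶠ n : ℕ, multiPair (p n) (iteratedFDeriv ℝ n h x)

/-- `h` is a polynomial function on `ℝ^d`. -/
def IsPolyFun (h : Vd d → ℝ) : Prop :=
  ∃ p : MvPolynomial (Fin d) ℝ, ∀ x : Vd d, h x = MvPolynomial.eval (fun i => x i) p

/-- `h` is a polynomial function of degree at most `r` on `ℝ^d`. -/
def IsPolyFunOfDeg (h : Vd d → ℝ) (r : ℕ) : Prop :=
  ∃ p : MvPolynomial (Fin d) ℝ, p.totalDegree ≤ r ∧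
    ∀ x : Vd d, h x = MvPolynomial.eval (fun i => x i) p

end

namespace MuAux

/-! ### Equality of meromorphic germs -/

lemma meroEq_refl {d : ℕ} (f : Vd d → ℝ) : MeroEqAt0 f f :=
  ⟨∅, isClosed_empty, interior_empty, Eventually.of_forall fun _ _ => rfl⟩

lemma meroEq_of_eq {d : ℕ} {f g : Vd d → ℝ} (h : ∀ ξ, f ξ = g ξ) : MeroEqAt0 f g :=
  ⟨∅, isClosed_empty, interior_empty, Eventually.of_forall fun ξ _ => h ξ⟩

lemma meroEq_symm {d : ℕ} {f g : Vd d → ℝ} (h : MeroEqAt0 f g) : MeroEqAt0 g f := by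
  obtain ⟨Z, h1, h2, h3⟩ := h
  exact ⟨Z, h1, h2, h3.mono fun ξ h hz => (h hz).symm⟩

/-- combine two germ equalities -/
lemma meroEq_comb {d : ℕ} {f g f' g' p q : Vd d → ℝ} (h : MeroEqAt0 f g) (h' : MeroEqAt0 f' g')
    (H : ∀ ξ, f ξ = g ξ → f' ξ = g' ξ → p ξ = q ξ) : MeroEqAt0 p q := by
  obtain ⟨Z, h1, h2, h3⟩ := h
  obtain ⟨Z', h1', h2', h3'⟩ := h'
  refine ⟨Z ∪ Z', h1.union h1', ?_, ?_⟩
  · rw [interior_union_isClosed_of_interior_empty h1 h2', h2]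
  · filter_upwards [h3, h3'] with ξ a b hz
    exact H ξ (a fun h => hz (Or.inl h)) (b fun h => hz (Or.inr h))

lemma meroEq_trans {d : ℕ} {f g k : Vd d → ℝ} (h : MeroEqAt0 f g) (h' : MeroEqAt0 g k) :
    MeroEqAt0 f k := meroEq_comb h h' fun _ a b => a.trans b

lemma meroEq_mul {d : ℕ} {f g f' g' : Vd d → ℝ} (h : MeroEqAt0 f g) (h' : MeroEqAt0 f' g') :
    MeroEqAt0 (fun ξ => f ξ * f' ξ) (fun ξ => g ξ * g' ξ) :=
  meroEq_comb h h' fun _ a b => by rw [a, b]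

lemma meroEq_sum {d : ℕ} {ι : Type*} (s : Finset ι) {f g : ι → Vd d → ℝ}
    (h : ∀ i ∈ s, MeroEqAt0 (f i) (g i)) :
    MeroEqAt0 (fun ξ => ∑ i ∈ s, f i ξ) (fun ξ => ∑ i ∈ s, g i ξ) := by
  classical
  induction s using Finset.induction_on with
  | empty => exact meroEq_of_eq fun ξ => by simp
  | insert i s hi ih =>
    refine meroEq_comb (h i (Finset.mem_insert_self i s))
      (ih fun j hj => h j (Finset.mem_insert_of_mem hj)) fun ξ a b => ?_
    rw [Finset.sum_insert hi, Finset.sum_insert hi, a, b]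

/-- if two finite sums agree and all terms but one agree, the last ones agree -/
lemma meroEq_cancel {d : ℕ} {ι : Type*} (s : Finset ι) {A B c : ι → Vd d → ℝ} (i₀ : ι)
    (hi₀ : i₀ ∈ s)
    (hsum : MeroEqAt0 (fun ξ => ∑ i ∈ s, A i ξ * c i ξ) (fun ξ => ∑ i ∈ s, B i ξ * c i ξ))
    (h : ∀ i ∈ s, i ≠ i₀ → MeroEqAt0 (A i) (B i)) (hc : ∀ ξ, c i₀ ξ ≠ 0) :
    MeroEqAt0 (A i₀) (B i₀) := by
  classical
  have h1 := meroEq_sum (s.erase i₀) (f := fun i ξ => A i ξ * c i ξ)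
    (g := fun i ξ => B i ξ * c i ξ) (fun i hi => meroEq_mul
      (h i (Finset.mem_of_mem_erase hi) (Finset.ne_of_mem_erase hi)) (meroEq_refl _))
  refine meroEq_comb hsum h1 fun ξ a b => ?_
  rw [← Finset.add_sum_erase s _ hi₀, ← Finset.add_sum_erase s _ hi₀, b] at a
  exact mul_right_cancel₀ (hc ξ) (add_right_cancel a)

lemma meroEq_comp {d : ℕ} {f g : Vd d → ℝ} (h : MeroEqAt0 f g) (σ : Vd d ≃ₗ[ℝ] Vd d) :
    MeroEqAt0 (fun ξ => f (σ ξ)) (fun ξ => g (σ ξ)) := by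
  obtain ⟨Z, h1, h2, h3⟩ := h
  let τ := σ.toContinuousLinearEquiv
  refine ⟨τ ⁻¹' Z, h1.preimage τ.continuous, ?_, ?_⟩
  · have := τ.toHomeomorph.preimage_interior Z
    rw [h2] at this
    simpa using this.symm
  · have ht : Tendsto τ (𝓝 0) (𝓝 0) := by
      simpa using τ.continuous.tendsto 0
    exact ht.eventually h3

/-! ### Meromorphic functions -/

/-- quotient of analytic germs at `0` -/
def Mero {d : ℕ} (f : Vd d → ℝ) : Prop :=
  ∃ g h : Vd d → ℝ, AnalyticAt ℝ g 0 ∧ AnalyticAt ℝ h 0 ∧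
    (¬ ∀ᶠ ξ in 𝓝 (0 : Vd d), h ξ = 0) ∧
    (∀ᶠ ξ in 𝓝 (0 : Vd d), h ξ ≠ 0 → f ξ * h ξ = g ξ)

lemma Mero.of_rat {d : ℕ} {Λ : AddSubgroup (Vd d)} {f : Vd d → ℝ} (h : RatMeromorphicAt0 Λ f) :
    Mero f := by
  obtain ⟨g, k, ⟨p, hp, _⟩, ⟨q, hq, _⟩, h3, h4⟩ := h
  exact ⟨g, k, ⟨p, hp⟩, ⟨q, hq⟩, h3, h4⟩

lemma Mero.of_analytic {d : ℕ} {f : Vd d → ℝ} (h : AnalyticAt ℝ f 0) : Mero f :=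
  ⟨f, fun _ => 1, h, analyticAt_const, by simpa using (NeBot.ne inferInstance), by simp⟩

lemma analytic_ball {d : ℕ} {f : Vd d → ℝ} (h : AnalyticAt ℝ f 0) :
    ∀ᶠ r in 𝓝[>] (0 : ℝ), AnalyticOnNhd ℝ f (Metric.ball 0 r) := by
  have := h.eventually_analyticAt
  obtain ⟨r, hr, hb⟩ := Metric.eventually_nhds_iff_ball.1 this
  filter_upwards [Ioo_mem_nhdsGT hr] with r' hr' x hx
  exact hb x (Metric.ball_subset_ball hr'.2.le hx)

lemma ev_ball {d : ℕ} {p : Vd d → Prop} (h : ∀ᶠ ξ in 𝓝 (0 : Vd d), p ξ) :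
    ∀ᶠ r in 𝓝[>] (0 : ℝ), ∀ ξ ∈ Metric.ball (0 : Vd d) r, p ξ := by
  obtain ⟨r, hr, hb⟩ := Metric.eventually_nhds_iff_ball.1 h
  filter_upwards [Ioo_mem_nhdsGT hr] with r' hr' x hx
  exact hb x (Metric.ball_subset_ball hr'.2.le hx)

lemma analytic_zero_of_open {d : ℕ} {f : Vd d → ℝ} {r : ℝ}
    (h : AnalyticOnNhd ℝ f (Metric.ball 0 r)) {z : Vd d} (hz : z ∈ Metric.ball (0 : Vd d) r)
    (hf : ∀ᶠ ξ in 𝓝 z, f ξ = 0) : ∀ ξ ∈ Metric.ball (0 : Vd d) r, f ξ = 0 :=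
  h.eqOn_zero_of_preconnected_of_eventuallyEq_zero
    (convex_ball (0 : Vd d) r).isPreconnected hz hf

lemma analytic_mul_ne {d : ℕ} {f g : Vd d → ℝ} (hf : AnalyticAt ℝ f 0) (hg : AnalyticAt ℝ g 0)
    (hf0 : ¬ ∀ᶠ ξ in 𝓝 (0 : Vd d), f ξ = 0) (hg0 : ¬ ∀ᶠ ξ in 𝓝 (0 : Vd d), g ξ = 0) :
    ¬ ∀ᶠ ξ in 𝓝 (0 : Vd d), f ξ * g ξ = 0 := by
  intro h
  obtain ⟨r, ⟨⟨h1, h2⟩, h3⟩, hr⟩ := (((analytic_ball hf).and (analytic_ball hg)).and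
    (ev_ball h)).and self_mem_nhdsWithin |>.exists
  apply hg0
  have : ∃ z ∈ Metric.ball (0 : Vd d) r, f z ≠ 0 := by
    by_contra! hc
    exact hf0 (Filter.mem_of_superset (Metric.ball_mem_nhds 0 hr) hc)
  obtain ⟨z, hz, hfz⟩ := this
  refine Filter.mem_of_superset (Metric.ball_mem_nhds 0 hr) (analytic_zero_of_open h2 hz ?_)
  filter_upwards [(h1 z hz).continuousAt.eventually_ne hfz, Metric.isOpen_ball.mem_nhds hz]
    with ξ a b
  exact (mul_eq_zero.1 (h3 ξ b)).resolve_left a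

lemma Mero.mul {d : ℕ} {f g : Vd d → ℝ} (hf : Mero f) (hg : Mero g) :
    Mero (fun ξ => f ξ * g ξ) := by
  obtain ⟨a, b, ha, hb, hb0, h1⟩ := hf
  obtain ⟨a', b', ha', hb', hb0', h1'⟩ := hg
  refine ⟨fun ξ => a ξ * a' ξ, fun ξ => b ξ * b' ξ, ha.fun_mul ha', hb.fun_mul hb',
    analytic_mul_ne hb hb' hb0 hb0', ?_⟩
  filter_upwards [h1, h1'] with ξ p q hne
  rw [← p (left_ne_zero_of_mul hne), ← q (right_ne_zero_of_mul hne)]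
  ring

lemma Mero.comp {d : ℕ} {f : Vd d → ℝ} (hf : Mero f) (σ : Vd d ≃ₗ[ℝ] Vd d) :
    Mero (fun ξ => f (σ ξ)) := by
  obtain ⟨a, b, ha, hb, hb0, h1⟩ := hf
  let τ := σ.toContinuousLinearEquiv
  have ht : Tendsto τ (𝓝 0) (𝓝 0) := by
    simpa using τ.continuous.tendsto 0
  have ht' : Tendsto τ.symm (𝓝 0) (𝓝 0) := by
    simpa using τ.symm.continuous.tendsto 0
  have hτ : AnalyticAt ℝ τ 0 := (τ : Vd d →L[ℝ] Vd d).analyticAt 0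
  have e0 : τ 0 = 0 := map_zero τ
  refine ⟨fun ξ => a (τ ξ), fun ξ => b (τ ξ), AnalyticAt.fun_comp (by rwa [e0]) hτ,
    AnalyticAt.fun_comp (by rwa [e0]) hτ, ?_, ht.eventually h1⟩
  intro hc
  apply hb0
  have := ht'.eventually hc
  simpa using this

/-- identity theorem: two meromorphic germs that agree on a nonempty open cone are equal -/
lemma Mero.eq_of_cone {d : ℕ} {f g : Vd d → ℝ} (hf : Mero f) (hg : Mero g) (U : Set (Vd d))
    (hU : IsOpen U) (hne : U.Nonempty) (hs : ∀ ξ ∈ U, ∀ t : ℝ, 0 < t → t • ξ ∈ U)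
    (h : ∀ ξ ∈ U, f ξ = g ξ) : MeroEqAt0 f g := by
  obtain ⟨a, b, ha, hb, hb0, h1⟩ := hf
  obtain ⟨a', b', ha', hb', hb0', h1'⟩ := hg
  have hbb := hb.fun_mul hb'
  have hbb0 := analytic_mul_ne hb hb' hb0 hb0'
  have hD : AnalyticAt ℝ (fun ξ => (a ξ * b' ξ - a' ξ * b ξ) * (b ξ * b' ξ)) 0 :=
    ((ha.fun_mul hb').fun_sub (ha'.fun_mul hb)).fun_mul hbb
  obtain ⟨r, ⟨⟨h2, h3⟩, h4, h5⟩, hr⟩ := (((analytic_ball hbb).and (analytic_ball hD)).and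
    ((ev_ball h1).and (ev_ball h1'))).and self_mem_nhdsWithin |>.exists
  have hr : 0 < r := hr
  obtain ⟨u, hu⟩ := hne
  obtain ⟨t, ht, htu⟩ : ∃ t : ℝ, 0 < t ∧ t • u ∈ Metric.ball (0 : Vd d) r := by
    refine ⟨r / (2 * (‖u‖ + 1)), by positivity, ?_⟩
    rw [mem_ball_zero_iff, norm_smul, Real.norm_of_nonneg (by positivity), div_mul_eq_mul_div,
      div_lt_iff₀ (by positivity)]
    nlinarith [norm_nonneg u]
  have hz : ∀ ξ ∈ Metric.ball (0 : Vd d) r,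
      (a ξ * b' ξ - a' ξ * b ξ) * (b ξ * b' ξ) = 0 := by
    refine analytic_zero_of_open h3 htu ?_
    filter_upwards [hU.mem_nhds (hs u hu t ht), Metric.isOpen_ball.mem_nhds htu] with ξ p q
    by_cases hne : b ξ * b' ξ = 0
    · rw [hne, mul_zero]
    · rw [← h4 ξ q (left_ne_zero_of_mul hne), ← h5 ξ q (right_ne_zero_of_mul hne), h ξ p]
      ring
  refine ⟨Metric.closedBall 0 (r/2) ∩ (fun ξ => b ξ * b' ξ) ⁻¹' {0}, ?_, ?_, ?_⟩
  · refine ContinuousOn.preimage_isClosed_of_isClosed ?_ Metric.isClosed_closedBall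
      isClosed_singleton
    exact h2.continuousOn.mono (Metric.closedBall_subset_ball (by linarith))
  · by_contra hc
    obtain ⟨z, hz'⟩ := Set.nonempty_iff_ne_empty.2 hc
    apply hbb0
    refine Filter.mem_of_superset (Metric.ball_mem_nhds 0 hr) (analytic_zero_of_open h2
      (z := z) ?_ ?_)
    · exact Metric.closedBall_subset_ball (by linarith) (interior_subset hz').1
    · filter_upwards [isOpen_interior.mem_nhds hz'] with ξ hξ
      exact (interior_subset hξ).2
  · filter_upwards [Metric.ball_mem_nhds (0 : Vd d) (half_pos hr)] with ξ hξ hn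
    have hne : b ξ * b' ξ ≠ 0 := fun h0 => hn ⟨Metric.ball_subset_closedBall hξ, h0⟩
    have hξ' : ξ ∈ Metric.ball (0 : Vd d) r := Metric.ball_subset_ball (by linarith) hξ
    have := hz ξ hξ'
    have := (mul_eq_zero.1 this).resolve_right hne
    rw [← h4 ξ hξ' (left_ne_zero_of_mul hne), ← h5 ξ hξ' (right_ne_zero_of_mul hne)] at this
    have : (f ξ - g ξ) * (b ξ * b' ξ) = 0 := by linarith
    exact sub_eq_zero.1 ((mul_eq_zero.1 this).resolve_right hne)

end MuAux

namespace MuAux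

/-! ### The pairing -/

section pairing
variable {d : ℕ}

lemma pairE_add (ξ x y : Vd d) : pairE ξ (x + y) = pairE ξ x + pairE ξ y := inner_add_right _ _ _
lemma pairE_sub (ξ x y : Vd d) : pairE ξ (x - y) = pairE ξ x - pairE ξ y := inner_sub_right _ _ _
lemma pairE_smul (ξ x : Vd d) (t : ℝ) : pairE ξ (t • x) = t * pairE ξ x :=
  real_inner_smul_right _ _ _
lemma pairE_zero (ξ : Vd d) : pairE ξ 0 = 0 := inner_zero_right _
lemma pairE_sum {ι : Type*} (ξ : Vd d) (s : Finset ι) (f : ι → Vd d) :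
    pairE ξ (∑ i ∈ s, f i) = ∑ i ∈ s, pairE ξ (f i) := inner_sum _ _ _
lemma pairE_add_left (ξ η x : Vd d) : pairE (ξ + η) x = pairE ξ x + pairE η x :=
  inner_add_left _ _ _
lemma pairE_smul_left (ξ x : Vd d) (t : ℝ) : pairE (t • ξ) x = t * pairE ξ x :=
  real_inner_smul_left _ _ _
lemma pairE_le (ξ x : Vd d) : pairE ξ x ≤ ‖ξ‖ * ‖x‖ := real_inner_le_norm _ _
lemma pairE_sub_left (ξ η x : Vd d) : pairE (ξ - η) x = pairE ξ x - pairE η x :=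
  inner_sub_left _ _ _

lemma exists_pairE (f : Vd d →ₗ[ℝ] ℝ) : ∃ φ : Vd d, ∀ x, pairE φ x = f x := by
  refine ⟨(InnerProductSpace.toDual ℝ (Vd d)).symm (LinearMap.toContinuousLinearMap f), fun x => ?_⟩
  simp [pairE]

lemma continuous_pairE (ξ : Vd d) : Continuous (fun x => pairE ξ x) := by
  unfold pairE; fun_prop

lemma analytic_exp (x : Vd d) : AnalyticAt ℝ (fun ξ : Vd d => Real.exp (pairE ξ x)) 0 := by
  refine AnalyticAt.rexp ?_
  have : (fun ξ : Vd d => pairE ξ x) = (innerSL ℝ x) := by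
    ext ξ; simp [pairE, real_inner_comm]
  rw [this]
  exact ContinuousLinearMap.analyticAt _ _

end pairing

/-! ### Cones -/

section cones
variable {d : ℕ} {Λ : AddSubgroup (Vd d)} {c : Set (Vd d)}

lemma cone_zero (h : IsRatCone Λ c) : (0 : Vd d) ∈ c := by
  obtain ⟨n, v, hv, rfl⟩ := h
  exact ⟨0, by simp, by simp⟩

lemma cone_add (h : IsRatCone Λ c) {x y : Vd d} (hx : x ∈ c) (hy : y ∈ c) : x + y ∈ c := by
  obtain ⟨n, v, hv, rfl⟩ := h
  obtain ⟨t, ht, rfl⟩ := hx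
  obtain ⟨t', ht', rfl⟩ := hy
  exact ⟨t + t', fun i => add_nonneg (ht i) (ht' i), by simp [add_smul, Finset.sum_add_distrib]⟩

lemma cone_smul (h : IsRatCone Λ c) {x : Vd d} (hx : x ∈ c) {r : ℝ} (hr : 0 ≤ r) : r • x ∈ c := by
  obtain ⟨n, v, hv, rfl⟩ := h
  obtain ⟨t, ht, rfl⟩ := hx
  exact ⟨r • t, fun i => mul_nonneg hr (ht i), by simp [Finset.smul_sum, mul_smul]⟩

lemma cone_convex (h : IsRatCone Λ c) : Convex ℝ c := by
  intro x hx y hy a b ha hb _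
  exact cone_add h (cone_smul h hx ha) (cone_smul h hy hb)

lemma cone_span (h : IsRatCone Λ c) : c ⊆ Submodule.span ℝ (Λ : Set (Vd d)) := by
  obtain ⟨n, v, hv, rfl⟩ := h
  rintro _ ⟨t, ht, rfl⟩
  exact Submodule.sum_mem _ fun i _ => Submodule.smul_mem _ _ (Submodule.subset_span (hv i))

/-- a cone is spanned by its lattice points -/
lemma cone_span_lattice (h : IsRatCone Λ c) :
    Submodule.span ℝ ((Submodule.span ℝ c : Set (Vd d)) ∩ (Λ : Set (Vd d)))
      = Submodule.span ℝ c := by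
  apply le_antisymm
  · exact Submodule.span_le.2 fun x hx => hx.1
  · refine Submodule.span_le.2 ?_
    obtain ⟨n, v, hv, rfl⟩ := h
    rintro _ ⟨t, ht, rfl⟩
    refine Submodule.sum_mem _ fun i _ => Submodule.smul_mem _ _ (Submodule.subset_span ⟨?_, hv i⟩)
    refine Submodule.subset_span ⟨Pi.single i 1, fun j => ?_, ?_⟩
    · by_cases hij : j = i
      · subst hij; simp
      · simp [hij]
    · simp [Pi.single_apply]

/-- generators belong to the cone -/
lemma gen_mem {n : ℕ} (v : Fin n → Vd d) (i : Fin n) :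
    v i ∈ {x : Vd d | ∃ t : Fin n → ℝ, (∀ i, 0 ≤ t i) ∧ x = ∑ i, t i • v i} := by
  refine ⟨Pi.single i 1, fun j => ?_, ?_⟩
  · by_cases hij : j = i
    · subst hij; simp
    · simp [hij]
  · simp [Pi.single_apply]

lemma affCone_iff {a : Set (Vd d)} : IsRatAffineCone Λ a ↔
    ∃ s c, IsRatPoint Λ s ∧ IsRatCone Λ c ∧ a = (fun y => s + y) '' c := by
  constructor
  · rintro ⟨s, n, v, hs, hv, rfl⟩
    refine ⟨s, _, hs, ⟨n, v, hv, rfl⟩, ?_⟩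
    ext x
    constructor
    · rintro ⟨t, ht, rfl⟩
      exact ⟨_, ⟨t, ht, rfl⟩, rfl⟩
    · rintro ⟨_, ⟨t, ht, rfl⟩, rfl⟩
      exact ⟨t, ht, rfl⟩
  · rintro ⟨s, _, hs, ⟨n, v, hv, rfl⟩, rfl⟩
    refine ⟨s, n, v, hs, hv, ?_⟩
    ext x
    constructor
    · rintro ⟨_, ⟨t, ht, rfl⟩, rfl⟩
      exact ⟨t, ht, rfl⟩
    · rintro ⟨t, ht, rfl⟩
      exact ⟨_, ⟨t, ht, rfl⟩, rfl⟩

lemma cone_map (h : IsRatCone Λ c) (f : Vd d →ₗ[ℝ] Vd d) :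
    IsRatCone (AddSubgroup.map f.toAddMonoidHom Λ) (f '' c) := by
  obtain ⟨n, v, hv, rfl⟩ := h
  refine ⟨n, fun i => f (v i), fun i => ⟨v i, hv i, rfl⟩, ?_⟩
  ext x
  constructor
  · rintro ⟨_, ⟨t, ht, rfl⟩, rfl⟩
    exact ⟨t, ht, by simp⟩
  · rintro ⟨t, ht, rfl⟩
    exact ⟨_, ⟨t, ht, rfl⟩, by simp⟩

lemma ratPoint_map {s : Vd d} (h : IsRatPoint Λ s) (f : Vd d →ₗ[ℝ] Vd d) :
    IsRatPoint (AddSubgroup.map f.toAddMonoidHom Λ) (f s) := by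
  obtain ⟨q, hq, hs⟩ := h
  exact ⟨q, hq, ⟨_, hs, by simp⟩⟩

lemma ratPoint_span {s : Vd d} (h : IsRatPoint Λ s) : s ∈ Submodule.span ℝ (Λ : Set (Vd d)) := by
  obtain ⟨q, hq, hs⟩ := h
  have hq' : (q : ℝ) ≠ 0 := by exact_mod_cast hq
  have := Submodule.smul_mem _ ((q : ℝ)⁻¹) (Submodule.subset_span (R := ℝ) hs)
  rwa [smul_smul, inv_mul_cancel₀ hq', one_smul] at this

lemma ratPoint_add {s t : Vd d} (h : IsRatPoint Λ s) (h' : IsRatPoint Λ t) :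
    IsRatPoint Λ (s + t) := by
  obtain ⟨q, hq, hs⟩ := h
  obtain ⟨q', hq', hs'⟩ := h'
  refine ⟨q * q', mul_ne_zero hq hq', ?_⟩
  have h1 := Λ.zsmul_mem hs q'
  have h2 := Λ.zsmul_mem hs' q
  have := Λ.add_mem h1 h2
  convert this using 1
  rw [← Int.cast_smul_eq_zsmul ℝ, ← Int.cast_smul_eq_zsmul ℝ]
  push_cast
  rw [smul_add, smul_smul, smul_smul, mul_comm (q : ℝ)]

lemma ratPoint_of_mem {s : Vd d} (h : s ∈ Λ) : IsRatPoint Λ s :=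
  ⟨1, one_ne_zero, by simpa using h⟩

lemma ratPoint_mono {Λ' : AddSubgroup (Vd d)} (hl : Λ ≤ Λ') {s : Vd d} (h : IsRatPoint Λ s) :
    IsRatPoint Λ' s := by
  obtain ⟨q, hq, hs⟩ := h
  exact ⟨q, hq, hl hs⟩

lemma cone_mono {Λ' : AddSubgroup (Vd d)} (hl : Λ ≤ Λ') (h : IsRatCone Λ c) : IsRatCone Λ' c := by
  obtain ⟨n, v, hv, rfl⟩ := h
  exact ⟨n, v, fun i => hl (hv i), rfl⟩

lemma cone_sum {c' : Set (Vd d)} (h : IsRatCone Λ c) (h' : IsRatCone Λ c') :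
    IsRatCone Λ (c + c') := by
  obtain ⟨n, v, hv, rfl⟩ := h
  obtain ⟨n', v', hv', rfl⟩ := h'
  refine ⟨n + n', Fin.append v v', fun i => ?_, ?_⟩
  · refine Fin.addCases (fun i => ?_) (fun i => ?_) i
    · simpa using hv i
    · simpa using hv' i
  · ext x
    constructor
    · rintro ⟨_, ⟨t, ht, rfl⟩, _, ⟨t', ht', rfl⟩, rfl⟩
      refine ⟨Fin.append t t', fun i => ?_, ?_⟩
      · refine Fin.addCases (fun i => ?_) (fun i => ?_) i
        · simpa using ht i
        · simpa using ht' i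
      · simp [Fin.sum_univ_add]
    · rintro ⟨t, ht, rfl⟩
      refine ⟨_, ⟨fun i => t (Fin.castAdd n' i), fun i => ht _, rfl⟩,
        _, ⟨fun i => t (Fin.natAdd n i), fun i => ht _, rfl⟩, ?_⟩
      simp [Fin.sum_univ_add]

lemma affSum_eq (s s' : Vd d) (c c' : Set (Vd d)) :
    (fun y => s + y) '' c + (fun y => s' + y) '' c' = (fun y => (s + s') + y) '' (c + c') := by
  ext x
  constructor
  · rintro ⟨_, ⟨y, hy, rfl⟩, _, ⟨y', hy', rfl⟩, rfl⟩
    exact ⟨_, ⟨y, hy, y', hy', rfl⟩, by simp only; abel⟩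
  · rintro ⟨_, ⟨y, hy, y', hy', rfl⟩, rfl⟩
    exact ⟨_, ⟨y, hy, rfl⟩, _, ⟨y', hy', rfl⟩, by simp only; abel⟩

/-- the open cone of strictly decreasing directions -/
def Uc (c : Set (Vd d)) : Set (Vd d) := {ξ | ∃ ε : ℝ, 0 < ε ∧ ∀ y ∈ c, pairE ξ y ≤ -ε * ‖y‖}

lemma Uc_open (c : Set (Vd d)) : IsOpen (Uc c) := by
  rw [Metric.isOpen_iff]
  rintro ξ ⟨ε, hε, h⟩
  refine ⟨ε / 2, half_pos hε, fun η hη => ⟨ε / 2, half_pos hε, fun y hy => ?_⟩⟩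
  have h1 := h y hy
  have h2 := pairE_le (η - ξ) y
  rw [pairE_sub_left] at h2
  rw [Metric.mem_ball, dist_eq_norm] at hη
  nlinarith [norm_nonneg y]

lemma Uc_smul (c : Set (Vd d)) : ∀ ξ ∈ Uc c, ∀ t : ℝ, 0 < t → t • ξ ∈ Uc c := by
  rintro ξ ⟨ε, hε, h⟩ t ht
  refine ⟨t * ε, mul_pos ht hε, fun y hy => ?_⟩
  rw [pairE_smul_left]
  nlinarith [h y hy]

lemma Uc_mono {c c' : Set (Vd d)} (h : c ⊆ c') : Uc c' ⊆ Uc c := by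
  rintro ξ ⟨ε, hε, hh⟩
  exact ⟨ε, hε, fun y hy => hh y (h hy)⟩

lemma Uc_of_gen {n : ℕ} (v : Fin n → Vd d) (ξ : Vd d) (h : ∀ i, v i ≠ 0 → pairE ξ (v i) < 0) :
    ξ ∈ Uc {x : Vd d | ∃ t : Fin n → ℝ, (∀ i, 0 ≤ t i) ∧ x = ∑ i, t i • v i} := by
  classical
  obtain ⟨ε, hε, hb⟩ : ∃ ε : ℝ, 0 < ε ∧ ∀ i, pairE ξ (v i) ≤ -ε * ‖v i‖ := by
    have : ∀ i, ∃ ε : ℝ, 0 < ε ∧ pairE ξ (v i) ≤ -ε * ‖v i‖ := by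
      intro i
      by_cases hi : v i = 0
      · exact ⟨1, one_pos, by simp [hi, pairE_zero]⟩
      · have hp : 0 < ‖v i‖ := norm_pos_iff.2 hi
        refine ⟨- pairE ξ (v i) / ‖v i‖, div_pos (neg_pos.2 (h i hi)) hp, ?_⟩
        field_simp
        simp
    choose e he he' using this
    obtain ⟨ε, hε⟩ : ∃ ε : ℝ, 0 < ε ∧ ∀ i, ε ≤ e i := by
      rcases isEmpty_or_nonempty (Fin n) with hn | hn
      · exact ⟨1, one_pos, fun i => hn.elim i⟩
      · exact ⟨Finset.univ.inf' Finset.univ_nonempty e, (Finset.lt_inf'_iff _).2 fun i _ => he i,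
          fun i => Finset.inf'_le _ (Finset.mem_univ i)⟩
    exact ⟨ε, hε.1, fun i => (he' i).trans (by nlinarith [hε.2 i, norm_nonneg (v i)])⟩
  refine ⟨ε, hε, ?_⟩
  rintro _ ⟨t, ht, rfl⟩
  rw [pairE_sum]
  calc ∑ i, pairE ξ (t i • v i) ≤ ∑ i, -ε * ‖t i • v i‖ := by
        refine Finset.sum_le_sum fun i _ => ?_
        rw [pairE_smul, norm_smul, Real.norm_of_nonneg (ht i)]
        nlinarith [hb i, ht i]
    _ = -ε * ∑ i, ‖t i • v i‖ := by rw [Finset.mul_sum]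
    _ ≤ _ := by nlinarith [norm_sum_le Finset.univ (fun i => t i • v i)]

lemma Uc_nonempty (h : IsRatCone Λ c) (s : Vd d) (hl : ¬ ContainsLine ((fun y => s + y) '' c)) :
    (Uc c).Nonempty := by
  classical
  have hc := h
  obtain ⟨n, v, hv, rfl⟩ := h
  let K : Set (Vd d) := convexHull ℝ (v '' {i | v i ≠ 0})
  have hK : IsCompact K := 
    (Set.Finite.image v (Set.toFinite _)).isCompact_convexHull ℝ
  have h0 : (0 : Vd d) ∉ K := by
    intro h0
    rw [show K = convexHull ℝ (v '' {i | v i ≠ 0}) from rfl,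
      show v '' {i | v i ≠ 0} = ((Finset.univ.filter (fun i => v i ≠ 0)).image v : Finset (Vd d)) by
        ext; simp, Finset.mem_convexHull'] at h0
    obtain ⟨w, hw, hw1, hw0⟩ := h0
    obtain ⟨y, hy, hwy⟩ : ∃ y ∈ (Finset.univ.filter (fun i => v i ≠ 0)).image v, w y ≠ 0 := by
      by_contra! hcon
      rw [Finset.sum_eq_zero hcon] at hw1
      exact zero_ne_one hw1
    have hy0 := hy
    simp only [Finset.mem_image, Finset.mem_filter, Finset.mem_univ, true_and] at hy0
    obtain ⟨i, hi, rfl⟩ := hy0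
    apply hl
    have hgen : ∀ y ∈ (Finset.univ.filter (fun i => v i ≠ 0)).image v,
        y ∈ {x : Vd d | ∃ t : Fin n → ℝ, (∀ i, 0 ≤ t i) ∧ x = ∑ i, t i • v i} := by
      intro y hy
      simp only [Finset.mem_image, Finset.mem_filter, Finset.mem_univ, true_and] at hy
      obtain ⟨i, hi, rfl⟩ := hy
      exact gen_mem v i
    have hneg : -v i ∈ {x : Vd d | ∃ t : Fin n → ℝ, (∀ i, 0 ≤ t i) ∧ x = ∑ i, t i • v i} := by
      rw [← Finset.add_sum_erase _ _ hy] at hw0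
      have e : -v i = (w (v i))⁻¹ • ∑ y ∈ ((Finset.univ.filter (fun i => v i ≠ 0)).image v).erase
          (v i), w y • y := by
        rw [← neg_eq_of_add_eq_zero_right hw0, smul_neg, smul_smul, inv_mul_cancel₀ hwy, one_smul]
      rw [e]
      refine cone_smul hc ?_ (inv_nonneg.2 (hw _ hy))
      refine Finset.sum_induction _ (· ∈ {x : Vd d | ∃ t : Fin n → ℝ, (∀ i, 0 ≤ t i) ∧
        x = ∑ i, t i • v i}) (fun _ _ => cone_add hc) (cone_zero hc) fun y hy => ?_
      exact cone_smul hc (hgen y (Finset.mem_of_mem_erase hy)) (hw y (Finset.mem_of_mem_erase hy))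
    refine ⟨s, v i, hi, fun t => ⟨t • v i, ?_, rfl⟩⟩
    rcases le_total 0 t with ht | ht
    · exact cone_smul hc (gen_mem v i) ht
    · have := cone_smul hc hneg (neg_nonneg.2 ht)
      rwa [smul_neg, neg_smul, neg_neg] at this
  obtain ⟨f, u, hf1, hf2⟩ := geometric_hahn_banach_closed_point (convex_convexHull ℝ _) hK.isClosed h0
  obtain ⟨φ, hφ⟩ := exists_pairE f.toLinearMap
  refine ⟨φ, Uc_of_gen v φ fun i hi => ?_⟩
  have h1 := hf1 (v i) (subset_convexHull ℝ _ ⟨i, hi, rfl⟩)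
  have h2 := hφ (v i)
  simp at hf2 h2
  linarith

lemma not_line_of_Uc (s : Vd d) (h : (Uc c).Nonempty) :
    ¬ ContainsLine ((fun y => s + y) '' c) := by
  rintro ⟨x, u, hu, hx⟩
  obtain ⟨ξ, ε, hε, h⟩ := h
  have key : ∀ t : ℝ, pairE ξ (x - s) + t * pairE ξ u ≤ -ε * ‖(x - s) + t • u‖ := by
    intro t
    obtain ⟨y, hy, he⟩ := hx t
    have e : y = (x - s) + t • u := by
      have : y = (s + y) - s := by abel
      rw [this]; simp only at he; rw [he]; abel
    have := h y hy
    rw [e, pairE_add, pairE_smul] at this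
    exact this
  have k0 : pairE ξ u = 0 := by
    by_contra hne
    have h1 := key ((-pairE ξ (x - s) + 1) / pairE ξ u)
    rw [div_mul_cancel₀ _ hne] at h1
    have : 0 ≤ ε * ‖(x - s) + ((-pairE ξ (x - s) + 1) / pairE ξ u) • u‖ := by positivity
    linarith
  have hup : 0 < ‖u‖ := norm_pos_iff.2 hu
  set M := ‖x - s‖ + (|pairE ξ (x - s)| + 1) / ε with hM
  have h2 := key (M / ‖u‖)
  rw [k0, mul_zero, add_zero] at h2
  have h3 : M - ‖x - s‖ ≤ ‖(x - s) + (M / ‖u‖) • u‖ := by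
    have h4 := norm_sub_norm_le ((M / ‖u‖) • u) (-(x - s))
    have hMp : 0 ≤ M := by positivity
    rw [norm_smul, Real.norm_of_nonneg (by positivity), div_mul_cancel₀ _ hup.ne', norm_neg,
      sub_neg_eq_add, add_comm ((M / ‖u‖) • u)] at h4
    exact h4
  have h5 : ε * (M - ‖x - s‖) = |pairE ξ (x - s)| + 1 := by
    rw [hM]; field_simp; ring
  have h6 := neg_abs_le (pairE ξ (x - s))
  nlinarith

end cones

end MuAux

namespace MuAux

/-! ### Lattices -/

section lattices
variable {d : ℕ}

/-- a subgroup with finitely many points in each ball -/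
def Disc (M : AddSubgroup (Vd d)) : Prop :=
  ∀ r : ℝ, (Metric.closedBall (0 : Vd d) r ∩ (M : Set (Vd d))).Finite

lemma Disc.mono {M N : AddSubgroup (Vd d)} (h : Disc N) (hMN : M ≤ N) : Disc M :=
  fun r => (h r).subset (inter_subset_inter_right _ hMN)

lemma Disc.discrete {M : AddSubgroup (Vd d)} (h : Disc M) : DiscreteTopology M := by
  apply discreteTopology_of_isOpen_singleton_zero
  have hf : ((Metric.closedBall (0 : Vd d) 1 ∩ (M : Set (Vd d))) \ {0}).Finite :=
    (h 1).subset sdiff_subset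
  rw [isOpen_induced_iff]
  refine ⟨Metric.ball 0 1 ∩ ((Metric.closedBall (0 : Vd d) 1 ∩ (M : Set (Vd d))) \ {0})ᶜ,
    Metric.isOpen_ball.inter hf.isClosed.isOpen_compl, ?_⟩
  ext ⟨x, hx⟩
  simp only [mem_preimage, mem_inter_iff, mem_compl_iff, Set.mem_sdiff, SetLike.mem_coe, hx,
    and_true, mem_singleton_iff, not_and, not_not, AddSubgroup.mk_eq_zero]
  constructor
  · rintro ⟨h1, h2⟩
    exact h2 (Metric.ball_subset_closedBall h1)
  · rintro rfl
    simp

lemma Disc.of_discrete {M : AddSubgroup (Vd d)} (h : DiscreteTopology M) : Disc M := by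
  intro r
  exact Metric.finite_isBounded_inter_isClosed DiscreteTopology.isDiscrete
        Metric.isBounded_closedBall inferInstance

lemma disc_full {Λ : AddSubgroup (Vd d)} (h : IsFullLattice Λ) : Disc Λ := by
  obtain ⟨⟨k, v, hv, rfl⟩, hs⟩ := h
  have e : AddSubgroup.closure (Set.range v) = (Submodule.span ℤ (Set.range v)).toAddSubgroup := by
    rw [Submodule.span_int_eq_addSubgroupClosure]
  have hsp : ⊤ ≤ Submodule.span ℝ (Set.range v) := by
    rw [← hs]
    refine Submodule.span_le.2 fun x hx => ?_
    have : AddSubgroup.closure (Set.range v) ≤ (Submodule.span ℝ (Set.range v)).toAddSubgroup :=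
      (AddSubgroup.closure_le _).2 Submodule.subset_span
    exact this hx
  let b := Module.Basis.mk hv hsp
  have hb : Set.range b = Set.range v := by simp [b]
  apply Disc.of_discrete
  rw [e, ← hb]
  exact (inferInstance : DiscreteTopology (Submodule.span ℤ (Set.range b)))

lemma exists_basis {M : AddSubgroup (Vd d)} (h : Disc M) :
    ∃ (k : ℕ) (v : Fin k → Vd d), LinearIndependent ℝ v ∧ (∀ i, v i ∈ M) ∧
      ∀ y ∈ M, ∃ c : Fin k → ℤ, y = ∑ i, (c i : ℝ) • v i := by
  have hd := h.discrete
  let L : Submodule ℤ (Vd d) := M.toIntSubmodule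
  have hdL : DiscreteTopology L := hd
  let f := (Submodule.span ℝ (L : Set (Vd d))).subtype
  let L₀ := L.comap (f.restrictScalars ℤ)
  have h_img : f '' L₀ = L := by
    rw [← LinearMap.coe_restrictScalars ℤ f, ← Submodule.map_coe (f.restrictScalars ℤ),
      Submodule.map_comap_eq_self]
    exact fun x hx ↦ LinearMap.mem_range.mpr ⟨⟨x, Submodule.subset_span hx⟩, rfl⟩
  have hdis : DiscreteTopology L₀ := by
    refine DiscreteTopology.preimage_of_continuous_injective (L : Set (Vd d)) ?_
      (Submodule.injective_subtype _)
    exact LinearMap.continuous_of_finiteDimensional f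
  have : IsZLattice ℝ L₀ := ⟨by
    rw [← (Submodule.map_injective_of_injective (Submodule.injective_subtype _)).eq_iff,
      Submodule.map_span, Submodule.map_top, Submodule.range_subtype, h_img]⟩
  have hfin : Module.Finite ℤ L₀ := ZLattice.module_finite ℝ L₀
  have hfree : Module.Free ℤ L₀ := ZLattice.module_free ℝ L₀
  let b := Module.finBasis ℤ L₀
  let B := b.ofZLatticeBasis ℝ L₀
  refine ⟨_, fun i => ((b i : Submodule.span ℝ (L : Set (Vd d))) : Vd d), ?_, ?_, ?_⟩
  · have h1 := B.linearIndependent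
    have h2 := h1.map' f (by simp [f])
    have h3 : (fun i => ((b i : Submodule.span ℝ (L : Set (Vd d))) : Vd d)) = f ∘ B := by
      ext i
      simp [B, f]
    rw [h3]
    exact h2
  · intro i
    exact (b i).2
  · intro y hy
    let y' : L₀ := ⟨⟨y, Submodule.subset_span hy⟩, hy⟩
    refine ⟨fun i => b.repr y' i, ?_⟩
    have h1 := b.sum_repr y'
    have h2 := congrArg (fun z : L₀ => ((z : Submodule.span ℝ (L : Set (Vd d))) : Vd d)) h1
    simp only [Submodule.coe_sum, Submodule.coe_smul, y'] at h2
    refine h2.symm.trans (Finset.sum_congr rfl fun i _ => ?_)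
    exact (Int.cast_smul_eq_zsmul ℝ _ _).symm

lemma exists_basis_sub {M : AddSubgroup (Vd d)} (h : Disc M) (L : Submodule ℝ (Vd d))
    (hL : Submodule.span ℝ ((L : Set (Vd d)) ∩ (M : Set (Vd d))) = L) :
    ∃ (k : ℕ) (v : Fin k → Vd d), LinearIndependent ℝ v ∧ (∀ i, v i ∈ M) ∧
      Submodule.span ℝ (Set.range v) = L ∧
      ∀ y ∈ M, y ∈ L → ∃ c : Fin k → ℤ, y = ∑ i, (c i : ℝ) • v i := by
  obtain ⟨k, v, h1, h2, h3⟩ := exists_basis (h.mono (inf_le_right : L.toAddSubgroup ⊓ M ≤ M))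
  refine ⟨k, v, h1, fun i => (h2 i).2, ?_, fun y hy hyL => h3 y ⟨hyL, hy⟩⟩
  apply le_antisymm
  · refine Submodule.span_le.2 ?_
    rintro _ ⟨i, rfl⟩
    exact (h2 i).1
  · rw [← hL]
    refine Submodule.span_le.2 fun y hy => ?_
    obtain ⟨c, rfl⟩ := h3 y hy
    exact Submodule.sum_mem _ fun i _ => Submodule.smul_mem _ _ (Submodule.subset_span ⟨i, rfl⟩)

/-! ### Orthogonal projections -/

variable {Q : Vd d →ₗ[ℝ] Vd d →ₗ[ℝ] ℝ} {Λ : AddSubgroup (Vd d)}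

lemma Q_zero (hQ : IsRatInner Λ Q) {x : Vd d} (h : Q x x = 0) : x = 0 := by
  by_contra hx
  exact (hQ.2.1 x hx).ne' h

lemma coproj_unique (hQ : IsRatInner Λ Q) {L : Submodule ℝ (Vd d)} {π : Vd d →ₗ[ℝ] Vd d}
    (hπ : IsQCoproj Q L π) {y z : Vd d} (h1 : y - z ∈ L) (h2 : ∀ l ∈ L, Q z l = 0) : π y = z := by
  have h3 : π y - z ∈ L := by
    have := L.sub_mem h1 (hπ.1 y)
    simpa using this
  have : Q (π y - z) (π y - z) = 0 := by
    conv_lhs => rw [map_sub Q, LinearMap.sub_apply]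
    rw [hπ.2 y _ h3, h2 _ h3, sub_zero]
  exact sub_eq_zero.1 (Q_zero hQ this)

lemma coproj_kill (hQ : IsRatInner Λ Q) {L : Submodule ℝ (Vd d)} {π : Vd d →ₗ[ℝ] Vd d}
    (hπ : IsQCoproj Q L π) {y : Vd d} (h : y ∈ L) : π y = 0 :=
  coproj_unique hQ hπ (by simpa using h) (by simp)

lemma exists_coproj (hQ : IsRatInner Λ Q) (L : Submodule ℝ (Vd d)) :
    ∃ π : Vd d →ₗ[ℝ] Vd d, IsQCoproj Q L π := by
  have hrefl : LinearMap.IsRefl (B := Q) := fun x y h => by rw [hQ.1]; exact h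
  have hnd : (LinearMap.BilinForm.restrict Q L).Nondegenerate := by
    constructor
    · intro x hx
      have := hx x
      exact Subtype.ext (Q_zero hQ this)
    · intro x hx
      have := hx x
      exact Subtype.ext (Q_zero hQ this)
  have hc := LinearMap.BilinForm.isCompl_orthogonal_of_restrict_nondegenerate hrefl hnd
  let p := Submodule.projection _ _ hc.symm
  refine ⟨p, fun x => Submodule.sub_projection_mem hc.symm x, fun x y hy => ?_⟩
  have : p x ∈ LinearMap.BilinForm.orthogonal Q L := Submodule.projection_apply_mem hc.symm x
  rw [LinearMap.BilinForm.mem_orthogonal_iff] at this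
  rw [hQ.1]
  exact this y hy

open Classical in
/-- a chosen orthogonal projection along `L` -/
noncomputable def qp (Q : Vd d →ₗ[ℝ] Vd d →ₗ[ℝ] ℝ) (L : Submodule ℝ (Vd d)) : Vd d →ₗ[ℝ] Vd d :=
  if h : ∃ π : Vd d →ₗ[ℝ] Vd d, IsQCoproj Q L π then h.choose else 0

lemma qp_spec (hQ : IsRatInner Λ Q) (L : Submodule ℝ (Vd d)) : IsQCoproj Q L (qp Q L) := by
  unfold qp
  rw [dif_pos (exists_coproj hQ L)]
  exact (exists_coproj hQ L).choose_spec

lemma qp_bot (hQ : IsRatInner Λ Q) : qp Q ⊥ = LinearMap.id := by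
  ext1 x
  exact coproj_unique hQ (qp_spec hQ ⊥) (by simp) (by simp)

lemma qp_mem (hQ : IsRatInner Λ Q) {L W : Submodule ℝ (Vd d)} (h : L ≤ W) {x : Vd d}
    (hx : x ∈ W) : qp Q L x ∈ W := by
  have := W.sub_mem hx (h ((qp_spec hQ L).1 x))
  simpa using this

/-- quotient lattices are discrete -/
lemma disc_quot (hΛ : IsFullLattice Λ) (hQ : IsRatInner Λ Q) {Λ' : AddSubgroup (Vd d)}
    (h : IsQuotLattice Q Λ Λ') : Disc Λ' := by
  obtain ⟨L, π, hL, hπ, rfl⟩ := h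
  obtain ⟨k, e, he1, he2, he3, -⟩ := exists_basis_sub (disc_full hΛ) L hL
  intro r
  refine ((disc_full hΛ (r + ∑ i, ‖e i‖)).image π).subset ?_
  rintro _ ⟨hr, x, hx, rfl⟩
  have h1 : x - π x ∈ Submodule.span ℝ (Set.range e) := by rw [he3]; exact hπ.1 x
  obtain ⟨t, ht⟩ := (Submodule.mem_span_range_iff_exists_fun ℝ).1 h1
  have heL : ∀ i, e i ∈ L := fun i => by rw [← he3]; exact Submodule.subset_span ⟨i, rfl⟩
  refine ⟨x - ∑ i, (⌊t i⌋) • e i, ⟨?_, ?_⟩, ?_⟩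
  · have e2 : x - ∑ i, (⌊t i⌋) • e i = π x + ∑ i, Int.fract (t i) • e i := by
      have : ∑ i, Int.fract (t i) • e i = ∑ i, t i • e i - ∑ i, (⌊t i⌋) • e i := by
        rw [← Finset.sum_sub_distrib]
        refine Finset.sum_congr rfl fun i _ => ?_
        rw [← Int.cast_smul_eq_zsmul ℝ, ← sub_smul]
        rfl
      rw [this, ht]; abel
    rw [mem_closedBall_zero_iff] at hr ⊢
    rw [e2]
    refine (norm_add_le _ _).trans (add_le_add hr ((norm_sum_le _ _).trans
      (Finset.sum_le_sum fun i _ => ?_)))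
    rw [norm_smul, Real.norm_of_nonneg (Int.fract_nonneg _)]
    exact mul_le_of_le_one_left (norm_nonneg _) (Int.fract_lt_one _).le
  · exact Λ.sub_mem hx (Λ.sum_mem fun i _ => Λ.zsmul_mem (he2 i) _)
  · rw [map_sub, map_sum]
    simp [coproj_kill hQ hπ (heL _)]

/-- quotients of quotients -/
lemma quot_quot (hQ : IsRatInner Λ Q) {Λ' : AddSubgroup (Vd d)}
    (h : IsQuotLattice Q Λ Λ') (L' : Submodule ℝ (Vd d))
    (hL' : Submodule.span ℝ ((L' : Set (Vd d)) ∩ (Λ' : Set (Vd d))) = L')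
    {π' : Vd d →ₗ[ℝ] Vd d} (hπ' : IsQCoproj Q L' π') :
    IsQuotLattice Q Λ (AddSubgroup.map π'.toAddMonoidHom Λ') := by
  obtain ⟨L, π, hL, hπ, rfl⟩ := h
  have horth : ∀ l' ∈ L', ∀ l ∈ L, Q l' l = 0 := by
    intro l' hl' l hl
    rw [← hL'] at hl'
    induction hl' using Submodule.span_induction with
    | mem x hx =>
      obtain ⟨y, hy, rfl⟩ := hx.2
      exact hπ.2 y l hl
    | zero => simp
    | add x y _ _ hx hy => simp [hx, hy]
    | smul a x _ hx => simp [hx]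
  have hmem : ∀ x, π (x : Vd d) - π' (π x) ∈ L' := fun x => hπ'.1 _
  refine ⟨L ⊔ L', π' ∘ₗ π, ?_, ⟨fun x => ?_, fun x y hy => ?_⟩, ?_⟩
  · apply le_antisymm
    · exact Submodule.span_le.2 fun x hx => hx.1
    · refine sup_le ?_ ?_
      · conv_lhs => rw [← hL]
        refine Submodule.span_mono fun x hx => ⟨(le_sup_left : L ≤ L ⊔ L') hx.1, hx.2⟩
      · conv_lhs => rw [← hL']
        refine Submodule.span_le.2 ?_
        rintro x ⟨hx, y, hy, rfl⟩
        have h1 : y - π y ∈ Submodule.span ℝ (((L ⊔ L' : Submodule ℝ (Vd d)) : Set (Vd d)) ∩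
            (Λ : Set (Vd d))) := by
          have := hπ.1 y
          rw [← hL] at this
          refine Submodule.span_mono ?_ this
          exact fun x hx => ⟨(le_sup_left : L ≤ L ⊔ L') hx.1, hx.2⟩
        have h2 : y ∈ Submodule.span ℝ (((L ⊔ L' : Submodule ℝ (Vd d)) : Set (Vd d)) ∩
            (Λ : Set (Vd d))) := by
          refine Submodule.subset_span ⟨?_, hy⟩
          have := (L ⊔ L').add_mem ((le_sup_left : L ≤ L ⊔ L') (hπ.1 y))
            ((le_sup_right : L' ≤ L ⊔ L') hx)
          simpa using this
        have := Submodule.sub_mem _ h2 h1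
        simpa using this
  · have := (L ⊔ L').add_mem ((le_sup_left : L ≤ L ⊔ L') (hπ.1 x))
            ((le_sup_right : L' ≤ L ⊔ L') (hmem x))
    simpa using this
  · obtain ⟨l, hl, l', hl', rfl⟩ := Submodule.mem_sup.1 hy
    rw [map_add]
    simp only [LinearMap.comp_apply]
    rw [hπ'.2 _ l' hl', add_zero]
    have e : π' (π x) = π x - (π x - π' (π x)) := by abel
    rw [e, map_sub, LinearMap.sub_apply, hπ.2 x l hl, horth _ (hmem x) l hl, sub_zero]
  · rw [AddSubgroup.map_map]
    rfl

lemma span_map (f : Vd d →ₗ[ℝ] Vd d) (M : AddSubgroup (Vd d)) :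
    Submodule.span ℝ (AddSubgroup.map f.toAddMonoidHom M : Set (Vd d)) =
      Submodule.map f (Submodule.span ℝ (M : Set (Vd d))) := by
  rw [Submodule.map_span]
  rfl

/-- the rank drops under projection along a nonzero rational subspace -/
lemma rank_drop (hQ : IsRatInner Λ Q) {Λ' : AddSubgroup (Vd d)} (L : Submodule ℝ (Vd d))
    (hL : L ≤ Submodule.span ℝ (Λ' : Set (Vd d))) (hne : L ≠ ⊥) :
    Module.finrank ℝ (Submodule.span ℝ
      (AddSubgroup.map (qp Q L).toAddMonoidHom Λ' : Set (Vd d))) <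
    Module.finrank ℝ (Submodule.span ℝ (Λ' : Set (Vd d))) := by
  rw [span_map]
  apply Submodule.finrank_lt_finrank_of_lt
  refine lt_of_le_of_ne ?_ ?_
  · rintro _ ⟨x, hx, rfl⟩
    exact qp_mem hQ hL hx
  · intro he
    apply hne
    rw [eq_bot_iff]
    intro l hl
    have h1 : l ∈ Submodule.map (qp Q L) (Submodule.span ℝ (Λ' : Set (Vd d))) := by
      rw [he]; exact hL hl
    obtain ⟨x, hx, rfl⟩ := h1
    exact Q_zero hQ ((qp_spec hQ L).2 x _ hl)

end lattices

/-! ### Weyl's theorem -/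

section weyl
variable {d : ℕ} {Λ : AddSubgroup (Vd d)}

lemma dual_comb {φ ψ : Vd d} (h1 : IsDualIntegral Λ φ) (h2 : IsDualIntegral Λ ψ) (a b : ℤ) :
    IsDualIntegral Λ ((a : ℝ) • φ + (b : ℝ) • ψ) := by
  intro x hx
  obtain ⟨m, hm⟩ := h1 x hx
  obtain ⟨n, hn⟩ := h2 x hx
  refine ⟨a * m + b * n, ?_⟩
  rw [pairE_add_left, pairE_smul_left, pairE_smul_left, hm, hn]
  push_cast; ring

lemma weyl (hD : Disc Λ) : ∀ (n : ℕ) (v : Fin n → Vd d), (∀ i, v i ∈ Λ) →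
    ∃ Φ : Set (Vd d), Φ.Finite ∧ (∀ φ ∈ Φ, IsDualIntegral Λ φ) ∧
      {x : Vd d | ∃ t : Fin n → ℝ, (∀ i, 0 ≤ t i) ∧ x = ∑ i, t i • v i} =
      {x | x ∈ Submodule.span ℝ (Λ : Set (Vd d)) ∧ ∀ φ ∈ Φ, pairE φ x ≤ 0} := by
  intro n
  induction n with
  | zero =>
    intro v hv
    obtain ⟨k, b, hb, hbΛ, hrep⟩ := exists_basis hD
    have hinj : LinearMap.ker (Fintype.linearCombination ℝ b) = ⊥ :=
      LinearMap.ker_eq_bot.2 (linearIndependent_iff_injective_fintypeLinearCombination.1 hb)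
    obtain ⟨g, hg⟩ := LinearMap.exists_leftInverse_of_injective _ hinj
    have hg' : ∀ c : Fin k → ℝ, g (∑ i, c i • b i) = c := fun c => by
      have := LinearMap.congr_fun hg c
      simpa [Fintype.linearCombination_apply] using this
    have hφ : ∀ i : Fin k, ∃ φ : Vd d, ∀ x, pairE φ x = g x i :=
      fun i => exists_pairE ((LinearMap.proj i).comp g)
    choose φ hφ using hφ
    refine ⟨Set.range φ ∪ Set.range (fun i => -φ i), (Set.finite_range _).union
      (Set.finite_range _), ?_, ?_⟩
    · have hdint : ∀ i, IsDualIntegral Λ (φ i) := by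
        intro i x hx
        obtain ⟨c, rfl⟩ := hrep x hx
        exact ⟨c i, by rw [hφ, hg']⟩
      rintro _ (⟨i, rfl⟩ | ⟨i, rfl⟩)
      · exact hdint i
      · have := dual_comb (hdint i) (hdint i) (-1) 0
        simpa using this
    · ext x
      simp only [mem_ofPred_eq]
      constructor
      · rintro ⟨t, -, rfl⟩
        simp [pairE_zero]
      · rintro ⟨hx, h⟩
        refine ⟨0, by simp, ?_⟩
        have hsp : Submodule.span ℝ (Λ : Set (Vd d)) ≤ Submodule.span ℝ (Set.range b) := by
          refine Submodule.span_le.2 fun y hy => ?_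
          obtain ⟨c, rfl⟩ := hrep y hy
          exact Submodule.sum_mem _ fun i _ =>
            Submodule.smul_mem _ _ (Submodule.subset_span ⟨i, rfl⟩)
        obtain ⟨c, rfl⟩ := (Submodule.mem_span_range_iff_exists_fun ℝ).1 (hsp hx)
        have : c = 0 := by
          ext i
          have h1 := h (φ i) (Or.inl ⟨i, rfl⟩)
          have h2 := h (-φ i) (Or.inr ⟨i, rfl⟩)
          have h3 : pairE (-φ i) (∑ j, c j • b j) = - pairE (φ i) (∑ j, c j • b j) :=
            inner_neg_left _ _
          rw [h3] at h2
          rw [hφ, hg'] at h1 h2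
          simp only [Pi.zero_apply]
          linarith
        simp [this]
  | succ n ih =>
    intro v hv
    obtain ⟨Φ, hfin, hdint, heq⟩ := ih (fun i => v i.castSucc) (fun i => hv _)
    set w := v (Fin.last n) with hw
    have hwΛ : w ∈ Λ := hv _
    -- value on `w`
    have hmem : ∀ x : Vd d, (x ∈ {x : Vd d | ∃ t : Fin (n+1) → ℝ, (∀ i, 0 ≤ t i) ∧
        x = ∑ i, t i • v i}) ↔ x ∈ Submodule.span ℝ (Λ : Set (Vd d)) ∧
          ∃ t : ℝ, 0 ≤ t ∧ ∀ φ ∈ Φ, pairE φ x ≤ t * pairE φ w := by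
      intro x
      have hw' : w ∈ Submodule.span ℝ (Λ : Set (Vd d)) := Submodule.subset_span hwΛ
      constructor
      · rintro ⟨t, ht, rfl⟩
        have : ∑ i : Fin n, t i.castSucc • v i.castSucc ∈
            {x | x ∈ Submodule.span ℝ (Λ : Set (Vd d)) ∧ ∀ φ ∈ Φ, pairE φ x ≤ 0} := by
          rw [← heq]
          exact ⟨fun i => t i.castSucc, fun i => ht _, rfl⟩
        rw [Fin.sum_univ_castSucc]
        refine ⟨Submodule.add_mem _ this.1 (Submodule.smul_mem _ _ hw'), t (Fin.last n), ht _,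
          fun φ hφ => ?_⟩
        rw [pairE_add, pairE_smul]
        linarith [this.2 φ hφ]
      · rintro ⟨hx, t, ht, h⟩
        have : x - t • w ∈ {x | x ∈ Submodule.span ℝ (Λ : Set (Vd d)) ∧ ∀ φ ∈ Φ, pairE φ x ≤ 0} := by
          refine ⟨Submodule.sub_mem _ hx (Submodule.smul_mem _ _ hw'), fun φ hφ => ?_⟩
          rw [pairE_sub, pairE_smul]
          linarith [h φ hφ]
        rw [← heq] at this
        obtain ⟨t', ht', he⟩ := this
        refine ⟨Fin.snoc t' t, fun i => ?_, ?_⟩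
        · refine Fin.lastCases ?_ (fun i => ?_) i
          · simpa using ht
          · simpa using ht' i
        · rw [Fin.sum_univ_castSucc]
          simp only [Fin.snoc_castSucc, Fin.snoc_last]
          rw [← he, ← hw]; abel
    refine ⟨{φ ∈ Φ | pairE φ w ≤ 0} ∪ (fun p : Vd d × Vd d =>
      pairE p.1 w • p.2 - pairE p.2 w • p.1) ''
      ({φ ∈ Φ | 0 < pairE φ w} ×ˢ {φ ∈ Φ | pairE φ w < 0}), ?_, ?_, ?_⟩
    · exact (hfin.subset (sep_subset _ _)).union
        (((hfin.subset (sep_subset _ _)).prod (hfin.subset (sep_subset _ _))).image _)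
    · rintro _ (h | ⟨⟨φ, ψ⟩, ⟨h1, h2⟩, rfl⟩)
      · exact hdint _ h.1
      · obtain ⟨m, hm⟩ := hdint φ h1.1 w hwΛ
        obtain ⟨k, hk⟩ := hdint ψ h2.1 w hwΛ
        have := dual_comb (hdint ψ h2.1) (hdint φ h1.1) m (-k)
        simp only at hm hk ⊢
        rw [hm, hk]
        convert this using 1
        push_cast
        rw [neg_smul, sub_eq_add_neg]
    · ext x
      rw [hmem x, mem_ofPred_eq]
      refine and_congr_right fun hx => ?_
      constructor
      · rintro ⟨t, ht, h⟩ _ (h' | ⟨⟨φ, ψ⟩, ⟨h1, h2⟩, rfl⟩)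
        · exact (h _ h'.1).trans (mul_nonpos_of_nonneg_of_nonpos ht h'.2)
        · have a1 := h φ h1.1
          have a2 := h ψ h2.1
          have b1 := h1.2
          have b2 := h2.2
          simp only at b1 b2
          rw [pairE_sub_left, pairE_smul_left, pairE_smul_left]
          nlinarith
      · intro h
        obtain ⟨t, ht0, ht1, ht2⟩ : ∃ t : ℝ, 0 ≤ t ∧
            (∀ φ ∈ Φ, 0 < pairE φ w → pairE φ x / pairE φ w ≤ t) ∧
            (∀ ψ ∈ Φ, pairE ψ w < 0 → t ≤ pairE ψ x / pairE ψ w) := by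
          -- the least admissible `t`
          let A : Set ℝ := insert 0 ((fun φ => pairE φ x / pairE φ w) '' {φ ∈ Φ | 0 < pairE φ w})
          have hA : A.Finite := ((hfin.subset (sep_subset _ _)).image _).insert _
          obtain ⟨t, htA, htm⟩ := hA.exists_maximal (⟨0, mem_insert _ _⟩ : A.Nonempty)
          have hmax : ∀ a ∈ A, a ≤ t := fun a ha => by
            rcases le_total a t with h | h
            · exact h
            · exact htm ha h
          refine ⟨t, hmax 0 (mem_insert _ _), fun φ hφ hp => hmax _ (mem_insert_of_mem _
            ⟨φ, ⟨hφ, hp⟩, rfl⟩), fun ψ hψ hn => ?_⟩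
          rcases htA with rfl | ⟨φ, ⟨hφ, hp⟩, rfl⟩
          · exact div_nonneg_of_nonpos (h ψ (Or.inl ⟨hψ, hn.le⟩)) hn.le
          · have := h _ (Or.inr ⟨⟨φ, ψ⟩, ⟨⟨hφ, hp⟩, ⟨hψ, hn⟩⟩, rfl⟩)
            rw [pairE_sub_left, pairE_smul_left, pairE_smul_left] at this
            simp only at hp this
            simp only
            rw [le_div_iff_of_neg hn, div_mul_eq_mul_div, le_div_iff₀ hp]
            linarith
        refine ⟨t, ht0, fun φ hφ => ?_⟩
        rcases lt_trichotomy (pairE φ w) 0 with hn | hz | hp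
        · have := ht2 φ hφ hn
          rwa [le_div_iff_of_neg hn] at this
        · have := h φ (Or.inl ⟨hφ, hz.le⟩)
          rw [hz, mul_zero]; exact this
        · have := ht1 φ hφ hp
          rwa [div_le_iff₀ hp] at this

/-- rational affine cones are rational polyhedra -/
lemma affCone_polyhedron (hD : Disc Λ) {s : Vd d} {c : Set (Vd d)} (hs : IsRatPoint Λ s)
    (hc : IsRatCone Λ c) : IsRatPolyhedron Λ ((fun y => s + y) '' c) := by
  obtain ⟨n, v, hv, rfl⟩ := hc
  obtain ⟨Φ, hfin, hdint, heq⟩ := weyl hD n v hv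
  obtain ⟨k, f, hf⟩ := hfin.fin_param
  have hmem : ∀ i, f i ∈ Φ := fun i => by rw [← hf.2]; exact ⟨i, rfl⟩
  have hrat : ∀ i, ∃ q : ℚ, pairE (f i) s = q := by
    intro i
    obtain ⟨q, hq, hqs⟩ := hs
    obtain ⟨m, hm⟩ := hdint _ (hmem i) _ hqs
    refine ⟨m / q, ?_⟩
    rw [pairE_smul] at hm
    have hq' : (q : ℝ) ≠ 0 := by exact_mod_cast hq
    push_cast
    rw [eq_div_iff hq', mul_comm]; exact hm
  choose q hq using hrat
  refine ⟨k, f, q, fun i => hdint _ (hmem i), ?_⟩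
  rw [heq]
  have hs' := ratPoint_span hs
  ext x
  constructor
  · rintro ⟨y, ⟨hy1, hy2⟩, rfl⟩
    refine ⟨Submodule.add_mem _ hs' hy1, fun i => ?_⟩
    simp only
    rw [pairE_add, hq]
    linarith [hy2 _ (hmem i)]
  · rintro ⟨h1, h2⟩
    refine ⟨x - s, ⟨Submodule.sub_mem _ h1 hs', fun φ hφ => ?_⟩, by simp⟩
    rw [← hf.2] at hφ
    obtain ⟨i, rfl⟩ := hφ
    rw [pairE_sub, hq]
    linarith [h2 i]

lemma cone_closed (hD : Disc Λ) {c : Set (Vd d)} (hc : IsRatCone Λ c) : IsClosed c := by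
  obtain ⟨n, v, hv, rfl⟩ := hc
  obtain ⟨Φ, hfin, hdint, heq⟩ := weyl hD n v hv
  rw [heq]
  have : {x | x ∈ Submodule.span ℝ (Λ : Set (Vd d)) ∧ ∀ φ ∈ Φ, pairE φ x ≤ 0} =
    (Submodule.span ℝ (Λ : Set (Vd d)) : Set (Vd d)) ∩ ⋂ φ ∈ Φ, {x | pairE φ x ≤ 0} := by
    ext; simp
  rw [this]
  exact (Submodule.closed_of_finiteDimensional _).inter
    (isClosed_biInter fun φ _ => isClosed_le (continuous_pairE φ) continuous_const)

end weyl

end MuAux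

namespace MuAux

/-! ### Convergence -/

section conv
variable {d : ℕ} {Λ : AddSubgroup (Vd d)}

lemma exp_bound {δ : ℝ} (hδ : 0 < δ) (n : ℕ) :
    ∃ C : ℝ, 0 ≤ C ∧ ∀ r : ℝ, 0 ≤ r → Real.exp (-δ * r) ≤ C * ((1 + r) ^ n)⁻¹ := by
  refine ⟨Real.exp δ * (n.factorial / δ ^ n), by positivity, fun r hr => ?_⟩
  have h := Real.pow_div_factorial_le_exp (δ * (1 + r)) (by positivity) n
  have e : Real.exp (-δ * r) = Real.exp δ * (Real.exp (δ * (1 + r)))⁻¹ := by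
    rw [← Real.exp_neg, ← Real.exp_add]; congr 1; ring
  rw [e, mul_assoc]
  refine mul_le_mul_of_nonneg_left ?_ (Real.exp_pos _).le
  have hp : 0 < (δ * (1 + r)) ^ n / n.factorial := by positivity
  refine (inv_anti₀ hp h).trans (le_of_eq ?_)
  rw [mul_pow]
  field_simp

lemma summable_cone (hD : Disc Λ) {s ξ : Vd d} {c : Set (Vd d)} (hξ : ξ ∈ Uc c) :
    Summable (fun x : ↥((fun y => s + y) '' c ∩ (Λ : Set (Vd d))) =>
      Real.exp (pairE ξ (x : Vd d))) := by
  obtain ⟨ε, hε, h⟩ := hξ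
  have hd := hD.discrete
  let L : Submodule ℤ (Vd d) := Λ.toIntSubmodule
  have hdL : DiscreteTopology L := hd
  set n := Module.finrank ℤ L + 1 with hn
  have h1 := ZLattice.summable_norm_pow_inv (L := L) n (by omega)
  obtain ⟨C, hC, hb⟩ := exp_bound hε n
  let j : ↥((fun y => s + y) '' c ∩ (Λ : Set (Vd d))) → L := fun x => ⟨x, x.2.2⟩
  have hj : Function.Injective j := fun x y hxy => by
    have := congrArg (fun z : L => (z : Vd d)) hxy
    exact Subtype.ext this
  have h2 := (h1.comp_injective hj).mul_left (Real.exp (pairE ξ s + ε * ‖s‖) * C)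
  refine h2.of_norm_bounded_eventually ?_
  have hfin : {x : ↥((fun y => s + y) '' c ∩ (Λ : Set (Vd d))) | (x : Vd d) = 0}.Finite := by
    refine Set.Subsingleton.finite ?_
    rintro x hx y hy
    exact Subtype.ext (Eq.trans hx (Eq.symm hy))
  filter_upwards [hfin.compl_mem_cofinite] with x hx
  have hx0 : (x : Vd d) ≠ 0 := hx
  rw [Real.norm_of_nonneg (Real.exp_pos _).le]
  obtain ⟨_, ⟨y, hy, rfl⟩, hxΛ⟩ := x
  simp only at hx0 ⊢
  have e1 : pairE ξ (s + y) ≤ (pairE ξ s + ε * ‖s‖) + -ε * ‖s + y‖ := by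
    rw [pairE_add]
    have := h y hy
    have := norm_add_le s y
    nlinarith
  calc Real.exp (pairE ξ (s + y)) ≤ Real.exp ((pairE ξ s + ε * ‖s‖) + -ε * ‖s + y‖) :=
        Real.exp_le_exp.2 e1
    _ = Real.exp (pairE ξ s + ε * ‖s‖) * Real.exp (-ε * ‖s + y‖) := Real.exp_add _ _
    _ ≤ Real.exp (pairE ξ s + ε * ‖s‖) * (C * ((1 + ‖s + y‖) ^ n)⁻¹) :=
        mul_le_mul_of_nonneg_left (hb _ (norm_nonneg _)) (Real.exp_pos _).le
    _ ≤ Real.exp (pairE ξ s + ε * ‖s‖) * (C * (‖s + y‖ ^ n)⁻¹) := by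
        have hpos : 0 < ‖s + y‖ := norm_pos_iff.2 hx0
        gcongr
        linarith
    _ = _ := by simp [j, mul_assoc]

/-- the integral of `e^{⟨ξ,x⟩}` over a cone, in the coordinates given by `v` -/
noncomputable def Jint {ι : Type*} [Fintype ι] (v : ι → Vd d) (c : Set (Vd d)) (ξ : Vd d) : ℝ :=
  ∫ t in {t : ι → ℝ | ∑ i, t i • v i ∈ c}, Real.exp (pairE ξ (∑ i, t i • v i))

lemma continuous_comb {ι : Type*} [Fintype ι] (v : ι → Vd d) :
    Continuous (fun t : ι → ℝ => ∑ i, t i • v i) := by fun_prop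

lemma comb_lower {ι : Type*} [Fintype ι] {v : ι → Vd d} (hv : LinearIndependent ℝ v) :
    ∃ δ : ℝ, 0 < δ ∧ ∀ t : ι → ℝ, δ * ‖t‖ ≤ ‖∑ i, t i • v i‖ := by
  have hinj := linearIndependent_iff_injective_fintypeLinearCombination.1 hv
  obtain ⟨K, hK, hl⟩ := (Fintype.linearCombination ℝ v).exists_antilipschitzWith
    (LinearMap.ker_eq_bot.2 hinj)
  refine ⟨(K : ℝ)⁻¹, by positivity, fun t => ?_⟩
  have := hl.le_mul_dist t 0
  simp only [dist_zero_right, map_zero, Fintype.linearCombination_apply] at this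
  rw [inv_mul_le_iff₀ (by positivity)]
  exact this

lemma integrable_cone {ι : Type*} [Fintype ι] {v : ι → Vd d} (hv : LinearIndependent ℝ v)
    {c : Set (Vd d)} (hc : IsClosed c) {ξ : Vd d} (hξ : ξ ∈ Uc c) :
    IntegrableOn (fun t : ι → ℝ => Real.exp (pairE ξ (∑ i, t i • v i)))
      {t : ι → ℝ | ∑ i, t i • v i ∈ c} := by
  obtain ⟨ε, hε, h⟩ := hξ
  obtain ⟨δ, hδ, hl⟩ := comb_lower hv
  obtain ⟨C, hC, hb⟩ := exp_bound (mul_pos hε hδ) (Module.finrank ℝ (ι → ℝ) + 1)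
  have hi : Integrable (fun t : ι → ℝ => C * (1 + ‖t‖) ^ (-((Module.finrank ℝ (ι → ℝ) + 1 : ℕ) : ℝ)))
      volume := (integrable_one_add_norm (by push_cast; linarith)).const_mul C
  have hmeas : MeasurableSet {t : ι → ℝ | ∑ i, t i • v i ∈ c} :=
    (hc.preimage (continuous_comb v)).measurableSet
  refine Integrable.mono' hi.integrableOn ?_ ?_
  · exact (Real.continuous_exp.comp ((continuous_pairE ξ).comp
      (continuous_comb v))).aestronglyMeasurable
  · rw [ae_restrict_iff' hmeas]
    refine Eventually.of_forall fun t ht => ?_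
    rw [Real.norm_of_nonneg (Real.exp_pos _).le]
    have h1 := h _ ht
    have h2 := hl t
    refine (Real.exp_le_exp.2 (show _ ≤ -(ε * δ) * ‖t‖ by nlinarith)).trans ?_
    refine (hb _ (norm_nonneg _)).trans (le_of_eq ?_)
    rw [Real.rpow_neg (by positivity), Real.rpow_natCast]

lemma affine_mem {s : Vd d} {c : Set (Vd d)} (h0 : (0 : Vd d) ∈ c) :
    (affineSpan ℝ ((fun y => s + y) '' c)).direction = Submodule.span ℝ c := by
  have hs : s ∈ (fun y => s + y) '' c := ⟨0, h0, by simp⟩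
  rw [direction_affineSpan, vectorSpan_eq_span_vsub_set_right ℝ hs]
  congr 1
  rw [image_image]
  simp

lemma affine_coe {s : Vd d} {c : Set (Vd d)} (h0 : (0 : Vd d) ∈ c) (x : Vd d) :
    x ∈ affineSpan ℝ ((fun y => s + y) '' c) ↔ x - s ∈ Submodule.span ℝ c := by
  rw [← affine_mem (s := s) h0, ← vsub_eq_sub,
    AffineSubspace.vsub_right_mem_direction_iff_mem]
  exact subset_affineSpan ℝ _ ⟨0, h0, by simp⟩

/-- data of a lattice basis of a subspace -/
structure LB {ι : Type*} (Λ : AddSubgroup (Vd d)) (L : Submodule ℝ (Vd d)) (v : ι → Vd d) [Fintype ι] :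
    Prop where
  li : LinearIndependent ℝ v
  mem : ∀ i, v i ∈ Λ
  span : Submodule.span ℝ (Set.range v) = L
  rep : ∀ y ∈ Λ, y ∈ L → ∃ c : ι → ℤ, y = ∑ i, (c i : ℝ) • v i

lemma exists_LB (hD : Disc Λ) {c : Set (Vd d)} (hc : IsRatCone Λ c) :
    ∃ (k : ℕ) (v : Fin k → Vd d), LB Λ (Submodule.span ℝ c) v := by
  obtain ⟨k, v, h1, h2, h3, h4⟩ := exists_basis_sub hD _ (cone_span_lattice hc)
  exact ⟨k, v, h1, h2, h3, h4⟩

lemma I_formula_fin (hD : Disc Λ) {I' : Set (Vd d) → Vd d → ℝ} (hI : IsIMap Λ I') {s : Vd d}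
    {c : Set (Vd d)} (hs : IsRatPoint Λ s) (hc : IsRatCone Λ c) {k : ℕ} {v : Fin k → Vd d}
    (hv : LB Λ (Submodule.span ℝ c) v) {ξ : Vd d} (hξ : ξ ∈ Uc c) :
    I' ((fun y => s + y) '' c) ξ = Real.exp (pairE ξ s) * Jint v c ξ := by
  have h0 := cone_zero hc
  have hcl := cone_closed hD hc
  let p : (Fin k → ℝ) → Vd d := fun t => s + ∑ i, t i • v i
  have hp : Continuous p := continuous_const.add (continuous_comb v)
  have hpre : p ⁻¹' ((fun y => s + y) '' c) = {t : Fin k → ℝ | ∑ i, t i • v i ∈ c} := by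
    ext t
    simp [p]
  have hmeasF : MeasurableSet ((fun y => s + y) '' c) :=
    ((Homeomorph.addLeft s).isClosedMap c hcl).measurableSet
  have hcan : IsCanonicalMeasure Λ
      ((affineSpan ℝ ((fun y => s + y) '' c) : AffineSubspace ℝ (Vd d)) : Set (Vd d))
      (Measure.map p volume) := by
    refine ⟨k, s, v, ?_, hv.mem, hv.li, ?_, ?_, rfl⟩
    · exact subset_affineSpan ℝ _ ⟨0, h0, by simp⟩
    · ext x
      rw [SetLike.mem_coe, affine_coe h0, ← hv.span, Submodule.mem_span_range_iff_exists_fun]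
      constructor
      · rintro ⟨t, ht⟩
        exact ⟨t, by rw [ht]; abel⟩
      · rintro ⟨t, rfl⟩
        exact ⟨t, by simp⟩
    · rw [hv.span]
      exact hv.rep
  have hfun : ∀ t, Real.exp (pairE ξ (p t)) =
      Real.exp (pairE ξ s) * Real.exp (pairE ξ (∑ i, t i • v i)) := fun t => by
    rw [← Real.exp_add, ← pairE_add]
  have hmeas : AEStronglyMeasurable (fun x => Real.exp (pairE ξ x)) (Measure.map p volume) :=
    (Real.continuous_exp.comp (continuous_pairE ξ)).aestronglyMeasurable
  rw [hI.2.2 _ (affCone_polyhedron hD hs hc) _ hcan ξ ?_]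
  · rw [setIntegral_map hmeasF hmeas hp.aemeasurable, hpre, Jint, ← integral_const_mul]
    simp_rw [hfun]
  · rw [IntegrableOn, Measure.restrict_map hp.measurable hmeasF, hpre,
      integrable_map_measure ?_ hp.aemeasurable]
    · have := (integrable_cone hv.li hcl hξ).const_mul (Real.exp (pairE ξ s))
      refine this.congr (Eventually.of_forall fun t => ?_)
      exact (hfun t).symm
    · exact (Real.continuous_exp.comp (continuous_pairE ξ)).aestronglyMeasurable

lemma Jint_reindex {ι κ : Type*} [Fintype ι] [Fintype κ] (e : ι ≃ κ) (v : κ → Vd d)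
    (c : Set (Vd d)) (ξ : Vd d) : Jint (v ∘ e) c ξ = Jint v c ξ := by
  have hm := volume_measurePreserving_piCongrLeft (fun _ : κ => ℝ) e
  have hs : ∀ t : ι → ℝ, ∑ i, (MeasurableEquiv.piCongrLeft (fun _ : κ => ℝ) e t) i • v i =
      ∑ i, t i • (v ∘ e) i := fun t => by
    rw [← e.sum_comp]
    refine Finset.sum_congr rfl fun i _ => ?_
    simp [MeasurableEquiv.coe_piCongrLeft, Equiv.piCongrLeft_apply_apply]
  have := hm.setIntegral_preimage_emb (MeasurableEquiv.measurableEmbedding _)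
    (fun t : κ → ℝ => Real.exp (pairE ξ (∑ i, t i • v i))) {t : κ → ℝ | ∑ i, t i • v i ∈ c}
  unfold Jint
  rw [← this]
  simp only [preimage_ofPred_eq, hs]

lemma I_formula (hD : Disc Λ) {I' : Set (Vd d) → Vd d → ℝ} (hI : IsIMap Λ I') {s : Vd d}
    {c : Set (Vd d)} (hs : IsRatPoint Λ s) (hc : IsRatCone Λ c) {ι : Type*} [Fintype ι]
    {v : ι → Vd d} (hv : LB Λ (Submodule.span ℝ c) v) {ξ : Vd d} (hξ : ξ ∈ Uc c) :
    I' ((fun y => s + y) '' c) ξ = Real.exp (pairE ξ s) * Jint v c ξ := by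
  let e := Fintype.equivFin ι
  have hrange : Set.range (v ∘ e.symm) = Set.range v := e.symm.surjective.range_comp v
  rw [I_formula_fin hD hI hs hc (v := v ∘ e.symm) ⟨?_, fun i => hv.mem _, ?_, ?_⟩ hξ,
    Jint_reindex]
  · exact hv.li.comp _ e.symm.injective
  · rw [hrange, hv.span]
  · intro y hy hyL
    obtain ⟨k, hk⟩ := hv.rep y hy hyL
    refine ⟨k ∘ e.symm, ?_⟩
    rw [hk, ← e.symm.sum_comp]
    rfl

lemma Jint_prod {ι κ : Type*} [Fintype ι] [Fintype κ] (v : ι → Vd d) (w : κ → Vd d)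
    (c c' : Set (Vd d)) (ξ : Vd d)
    (hsplit : ∀ (t : ι → ℝ) (t' : κ → ℝ), (∑ i, t i • v i) + (∑ i, t' i • w i) ∈ c + c' ↔
      (∑ i, t i • v i) ∈ c ∧ (∑ i, t' i • w i) ∈ c') :
    Jint (Sum.elim v w) (c + c') ξ = Jint v c ξ * Jint w c' ξ := by
  have hm := (volume_measurePreserving_sumPiEquivProdPi (fun _ : ι ⊕ κ => ℝ)).symm
  have hs : ∀ p : (ι → ℝ) × (κ → ℝ),
      ∑ i, ((MeasurableEquiv.sumPiEquivProdPi (fun _ : ι ⊕ κ => ℝ)).symm p) i • Sum.elim v w i =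
      ∑ i, p.1 i • v i + ∑ i, p.2 i • w i := fun p => by
    rw [Fintype.sum_sum_type]
    rfl
  have := hm.setIntegral_preimage_emb (MeasurableEquiv.measurableEmbedding _)
    (fun t : ι ⊕ κ → ℝ => Real.exp (pairE ξ (∑ i, t i • Sum.elim v w i)))
    {t : ι ⊕ κ → ℝ | ∑ i, t i • Sum.elim v w i ∈ c + c'}
  unfold Jint
  rw [← this]
  simp only [preimage_ofPred_eq, hs, hsplit]
  have e : {p : (ι → ℝ) × (κ → ℝ) | ∑ i, p.1 i • v i ∈ c ∧ ∑ i, p.2 i • w i ∈ c'} =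
    {t : ι → ℝ | ∑ i, t i • v i ∈ c} ×ˢ {t : κ → ℝ | ∑ i, t i • w i ∈ c'} := by
    ext; simp
  rw [e, ← setIntegral_prod_mul]
  simp only [pairE_add, Real.exp_add]
  rfl

end conv

end MuAux

namespace MuAux

/-! ### Faces of cones -/

section faces
variable {d : ℕ} {Λ Λ' : AddSubgroup (Vd d)} {Q : Vd d →ₗ[ℝ] Vd d →ₗ[ℝ] ℝ} {c k : Set (Vd d)}

local notation "tr(" s "," c ")" => Set.image (fun y => s + y) c

/-- faces of a cone with vertex at the origin -/
def CF (c k : Set (Vd d)) : Prop :=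
  ∃ φ : Vd d, (∀ y ∈ c, pairE φ y ≤ 0) ∧ k = {y | y ∈ c ∧ pairE φ y = 0}

lemma CF.sub (h : CF c k) : k ⊆ c := by
  obtain ⟨φ, _, rfl⟩ := h
  exact fun y hy => hy.1

lemma CF.zero (hc : IsRatCone Λ c) (h : CF c k) : (0 : Vd d) ∈ k := by
  obtain ⟨φ, _, rfl⟩ := h
  exact ⟨cone_zero hc, pairE_zero _⟩

lemma face_iff (hc : IsRatCone Λ c) (s : Vd d) (F : Set (Vd d)) :
    IsFaceOf (tr(s,c)) F ↔ ∃ k, CF c k ∧ F = tr(s,k) := by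
  constructor
  · rintro ⟨⟨x, hx⟩, φ, rfl⟩
    obtain ⟨⟨y0, hy0, rfl⟩, hx⟩ := hx
    have h1 : ∀ y ∈ c, pairE φ y ≤ pairE φ y0 := fun y hy => by
      have := hx _ ⟨y, hy, rfl⟩
      simpa [pairE_add] using this
    have h2 : pairE φ y0 = 0 := by
      have a1 := h1 _ (cone_zero hc)
      have a2 := h1 _ (cone_smul hc hy0 (zero_le_two))
      rw [pairE_zero] at a1
      rw [pairE_smul] at a2
      linarith
    rw [h2] at h1
    refine ⟨_, ⟨φ, h1, rfl⟩, ?_⟩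
    ext x
    constructor
    · rintro ⟨⟨y, hy, rfl⟩, h⟩
      refine ⟨y, ⟨hy, le_antisymm (h1 y hy) ?_⟩, rfl⟩
      have := h _ ⟨0, cone_zero hc, rfl⟩
      simpa [pairE_add, pairE_zero] using this
    · rintro ⟨y, ⟨hy, hy0⟩, rfl⟩
      refine ⟨⟨y, hy, rfl⟩, ?_⟩
      rintro _ ⟨z, hz, rfl⟩
      simp only [pairE_add, hy0]
      linarith [h1 z hz]
  · rintro ⟨k, hk, rfl⟩
    refine ⟨⟨_, 0, hk.zero hc, rfl⟩, ?_⟩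
    obtain ⟨φ, h1, rfl⟩ := hk
    refine ⟨φ, ?_⟩
    ext x
    constructor
    · rintro ⟨y, ⟨hy, hy0⟩, rfl⟩
      refine ⟨⟨y, hy, rfl⟩, ?_⟩
      rintro _ ⟨z, hz, rfl⟩
      simp only [pairE_add, hy0]
      linarith [h1 z hz]
    · rintro ⟨⟨y, hy, rfl⟩, h⟩
      refine ⟨y, ⟨hy, le_antisymm (h1 y hy) ?_⟩, rfl⟩
      have := h _ ⟨0, cone_zero hc, rfl⟩
      simpa [pairE_add, pairE_zero] using this

/-- the cone generated by `v` -/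
def gen {n : ℕ} (v : Fin n → Vd d) : Set (Vd d) :=
  {x : Vd d | ∃ t : Fin n → ℝ, (∀ i, 0 ≤ t i) ∧ x = ∑ i, t i • v i}

open Classical in
lemma CF_gen {n : ℕ} (v : Fin n → Vd d) (φ : Vd d) (h : ∀ y ∈ gen v, pairE φ y ≤ 0) :
    {y | y ∈ gen v ∧ pairE φ y = 0} = gen (fun i => if pairE φ (v i) = 0 then v i else 0) := by
  have hv : ∀ i, pairE φ (v i) ≤ 0 := fun i => h _ (gen_mem v i)
  ext y
  constructor
  · rintro ⟨⟨t, ht, rfl⟩, h0⟩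
    refine ⟨t, ht, Finset.sum_congr rfl fun i _ => ?_⟩
    rw [pairE_sum] at h0
    have := (Finset.sum_eq_zero_iff_of_nonpos (fun i _ => by
      rw [pairE_smul]; exact mul_nonpos_of_nonneg_of_nonpos (ht i) (hv i))).1 h0 i (Finset.mem_univ _)
    rw [pairE_smul] at this
    rcases mul_eq_zero.1 this with h | h
    · simp [h]
    · simp [h]
  · rintro ⟨t, ht, rfl⟩
    refine ⟨⟨fun i => if pairE φ (v i) = 0 then t i else 0, fun i => ?_, ?_⟩, ?_⟩
    · dsimp only; split_ifs
      · exact ht i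
      · exact le_rfl
    · refine Finset.sum_congr rfl fun i _ => ?_
      dsimp only
      split_ifs <;> simp
    · rw [pairE_sum]
      refine Finset.sum_eq_zero fun i _ => ?_
      dsimp only
      split_ifs with hi
      · rw [pairE_smul, hi, mul_zero]
      · rw [smul_zero, pairE_zero]

lemma CF.cone (hc : IsRatCone Λ c) (h : CF c k) : IsRatCone Λ k := by
  classical
  obtain ⟨n, v, hv, rfl⟩ := hc
  obtain ⟨φ, h1, rfl⟩ := h
  refine ⟨n, fun i => if pairE φ (v i) = 0 then v i else 0, fun i => ?_, CF_gen v φ h1⟩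
  dsimp only
  split_ifs
  · exact hv i
  · exact zero_mem _

lemma CF_finite (hc : IsRatCone Λ c) : {k | CF c k}.Finite := by
  classical
  obtain ⟨n, v, hv, rfl⟩ := hc
  refine (Set.finite_range (fun J : Finset (Fin n) => gen (fun i => if i ∈ J then v i else 0))).subset ?_
  rintro k ⟨φ, h1, rfl⟩
  refine ⟨Finset.univ.filter (fun i => pairE φ (v i) = 0), ?_⟩
  simp only [Finset.mem_filter, Finset.mem_univ, true_and]
  exact (CF_gen v φ h1).symm

lemma CF_vertex (hc : IsRatCone Λ c) (hU : (Uc c).Nonempty) : CF c {0} := by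
  obtain ⟨ξ, ε, hε, h⟩ := hU
  refine ⟨ξ, fun y hy => (h y hy).trans (by nlinarith [norm_nonneg y]), ?_⟩
  ext y
  constructor
  · rintro rfl
    exact ⟨cone_zero hc, pairE_zero _⟩
  · rintro ⟨hy, h0⟩
    have := h y hy
    rw [h0] at this
    have : ‖y‖ ≤ 0 := by nlinarith [norm_nonneg y]
    exact norm_le_zero_iff.1 this

lemma CF.span_le (hc : IsRatCone Λ c) (h : CF c k) :
    Submodule.span ℝ k ≤ Submodule.span ℝ (Λ : Set (Vd d)) :=
  Submodule.span_le.2 (cone_span (h.cone hc))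

lemma span_ne_bot (h : (0 : Vd d) ∈ k) (hk : k ≠ {0}) : Submodule.span ℝ k ≠ ⊥ := by
  intro hs
  apply hk
  ext x
  constructor
  · intro hx
    have := Submodule.subset_span (R := ℝ) hx
    rw [hs] at this
    simpa using this
  · rintro rfl
    exact h

lemma span_zero_set : Submodule.span ℝ ({0} : Set (Vd d)) = ⊥ := by simp

/-- transverse cones are pointed -/
lemma CF.transverse_pointed (hQ : IsRatInner Λ Q) (hc : IsRatCone Λ' c) (h : CF c k) :
    (Uc (qp Q (Submodule.span ℝ k) '' c)).Nonempty := by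
  have hq := qp_spec hQ (Submodule.span ℝ k)
  set π := qp Q (Submodule.span ℝ k) with hπ
  obtain ⟨φ, h1, hk⟩ := h
  have hspan : ∀ y ∈ Submodule.span ℝ k, pairE φ y = 0 := by
    intro y hy
    induction hy using Submodule.span_induction with
    | mem x hx => rw [hk] at hx; exact hx.2
    | zero => exact pairE_zero _
    | add x y _ _ hx hy => rw [pairE_add, hx, hy, add_zero]
    | smul r x _ hx => rw [pairE_smul, hx, mul_zero]
  have hφ : ∀ y, pairE φ (π y) = pairE φ y := fun y => by
    have := hspan _ (hq.1 y)
    rw [pairE_sub] at this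
    linarith
  obtain ⟨n, v, hv, rfl⟩ := hc
  refine ⟨φ, ?_⟩
  have := Uc_of_gen (fun i => π (v i)) φ (fun i hi => by
    rw [hφ]
    refine lt_of_le_of_ne (h1 _ (gen_mem v i)) fun h0 => hi ?_
    refine coproj_kill hQ hq (Submodule.subset_span ?_)
    rw [hk]
    exact ⟨gen_mem v i, h0⟩)
  refine Uc_mono ?_ this
  rintro _ ⟨_, ⟨t, ht, rfl⟩, rfl⟩
  exact ⟨t, ht, by simp⟩

lemma suppCone_image (hQ : IsRatInner Λ Q) (hc : IsRatCone Λ' c) (h : CF c k) (s : Vd d)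
    {π : Vd d →ₗ[ℝ] Vd d} (hπ : IsQCoproj Q (Submodule.span ℝ k) π) :
    π '' suppCone (tr(s,c)) (tr(s,k)) = tr(π s,π '' c) := by
  have h0 := h.zero hc
  have hkill : ∀ y ∈ Submodule.span ℝ k, π y = 0 := fun y hy => coproj_kill hQ hπ hy
  ext z
  constructor
  · rintro ⟨_, ⟨a, ha, u, ⟨x, hx, ε, hε, hu⟩, rfl⟩, rfl⟩
    have hx' := intrinsicInterior_subset hx
    obtain ⟨y, hy, rfl⟩ := hx'
    obtain ⟨w, hw, hwe⟩ := hu ε hε le_rfl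
    have hwe' : w = y + ε • u := by
      have : s + w = s + (y + ε • u) := by rw [← add_assoc]; exact hwe
      exact add_left_cancel this
    have hpa : π a = π s := by
      have := hkill _ ((affine_coe h0 a).1 ha)
      rw [map_sub] at this
      exact sub_eq_zero.1 this
    refine ⟨π u, ⟨ε⁻¹ • w, cone_smul hc hw (inv_nonneg.2 hε.le), ?_⟩, ?_⟩
    · rw [hwe', map_smul, map_add, map_smul, hkill y (Submodule.subset_span hy), zero_add,
        smul_smul, inv_mul_cancel₀ hε.ne', one_smul]
    · simp only [map_add, hpa]
  · rintro ⟨_, ⟨y, hy, rfl⟩, rfl⟩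
    have hconv : Convex ℝ (tr(s,k)) := by
      have := (cone_convex (h.cone hc)).translate s
      exact this
    obtain ⟨x, hx⟩ := Set.Nonempty.intrinsicInterior hconv ⟨_, 0, h0, rfl⟩
    refine ⟨s + y, ⟨s, ?_, y, ⟨x, hx, 1, one_pos, ?_⟩, rfl⟩, by simp⟩
    · exact (affine_coe h0 s).2 (by simp)
    · intro t ht _
      obtain ⟨w, hw, rfl⟩ := intrinsicInterior_subset hx
      exact ⟨w + t • y, cone_add hc (h.sub hw) (cone_smul hc hy ht.le), by simp only; abel⟩

/-- quotient lattice attached to a face -/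
noncomputable def ql (Q : Vd d →ₗ[ℝ] Vd d →ₗ[ℝ] ℝ) (Λ' : AddSubgroup (Vd d)) (k : Set (Vd d)) :
    AddSubgroup (Vd d) :=
  AddSubgroup.map (qp Q (Submodule.span ℝ k)).toAddMonoidHom Λ'

lemma ql_quot (hQ : IsRatInner Λ Q) (h : IsQuotLattice Q Λ Λ') (hk : IsRatCone Λ' k) :
    IsQuotLattice Q Λ (ql Q Λ' k) :=
  quot_quot hQ h _ (cone_span_lattice hk) (qp_spec hQ _)

lemma image_tr (f : Vd d →ₗ[ℝ] Vd d) (s : Vd d) (c : Set (Vd d)) :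
    f '' (tr(s,c)) = tr(f s,f '' c) := by
  rw [image_image, image_image]
  simp

lemma Uc_zero : Uc ({0} : Set (Vd d)) = univ := by
  ext ξ
  simp only [mem_univ, iff_true]
  exact ⟨1, one_pos, fun y hy => by
    rw [mem_singleton_iff] at hy; subst hy; simp [pairE_zero]⟩

lemma ratCone_zero : IsRatCone Λ ({0} : Set (Vd d)) :=
  ⟨0, Fin.elim0, fun i => i.elim0, by ext; simp⟩

lemma I_vertex (hD : Disc Λ) {I' : Set (Vd d) → Vd d → ℝ} (hI : IsIMap Λ I') {s : Vd d}
    (hs : IsRatPoint Λ s) (ξ : Vd d) : I' (tr(s,{0})) ξ = Real.exp (pairE ξ s) := by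
  have hv : LB Λ (Submodule.span ℝ ({0} : Set (Vd d))) (Fin.elim0 : Fin 0 → Vd d) := by
    refine ⟨linearIndependent_empty_type, fun i => i.elim0, by simp, fun y _ hy => ⟨Fin.elim0, ?_⟩⟩
    simpa using hy
  rw [I_formula hD hI hs ratCone_zero hv (by rw [Uc_zero]; trivial)]
  simp [Jint, pairE_zero, volume_pi, Measure.real]

end faces

section master
variable {d : ℕ} {Λ Λ' : AddSubgroup (Vd d)} {Q : Vd d →ₗ[ℝ] Vd d →ₗ[ℝ] ℝ} {c k : Set (Vd d)}
  {I S μ : AddSubgroup (Vd d) → Set (Vd d) → Vd d → ℝ}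

local notation "tr(" s "," c ")" => Set.image (fun y => s + y) c

/-- the value of `μ` at the transverse cone along the face `s + k` of `s + c` -/
noncomputable def mt (Q : Vd d →ₗ[ℝ] Vd d →ₗ[ℝ] ℝ)
    (μ : AddSubgroup (Vd d) → Set (Vd d) → Vd d → ℝ) (Λ' : AddSubgroup (Vd d)) (s : Vd d)
    (c k : Set (Vd d)) : Vd d → ℝ :=
  μ (ql Q Λ' k) (tr(qp Q (Submodule.span ℝ k) s,qp Q (Submodule.span ℝ k) '' c))

lemma mt_vertex (hQ : IsRatInner Λ Q) (s : Vd d) (c : Set (Vd d)) :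
    mt Q μ Λ' s c {0} = μ Λ' (tr(s,c)) := by
  have : AddSubgroup.map (LinearMap.id : Vd d →ₗ[ℝ] Vd d).toAddMonoidHom Λ' = Λ' := by
    ext; simp
  simp only [mt, ql, span_zero_set, qp_bot hQ, this]
  simp

theorem master (hQ : IsRatInner Λ Q) (hμ : IsMuFamily Λ Q I S μ)
    (hq : IsQuotLattice Q Λ Λ') {s : Vd d} (hs : IsRatPoint Λ' s) (hc : IsRatCone Λ' c)
    (hU : (Uc c).Nonempty) :
    MeroEqAt0 (S Λ' (tr(s,c))) (fun ξ => ∑ k ∈ (CF_finite hc).toFinset,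
      mt Q μ Λ' s c k ξ * I Λ' (tr(s,k)) ξ) := by
  have h := hμ.1.2.2 Λ' hq (tr(s,c)) (affCone_iff.2 ⟨s, c, hs, hc, rfl⟩) (not_line_of_Uc s hU)
    (fun F => qp Q (affineSpan ℝ F).direction) (fun F _ => qp_spec hQ _)
  refine meroEq_trans h (meroEq_of_eq fun ξ => ?_)
  have e : {F | IsFaceOf (tr(s,c)) F} = (fun k => tr(s,k)) '' {k | CF c k} := by
    ext F
    rw [mem_ofPred_eq, face_iff hc]
    constructor
    · rintro ⟨k, hk, rfl⟩; exact ⟨k, hk, rfl⟩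
    · rintro ⟨k, hk, rfl⟩; exact ⟨k, hk, rfl⟩
  have hinj : Set.InjOn (fun k : Set (Vd d) => tr(s,k)) {k | CF c k} :=
    fun x _ y _ hxy => (Set.image_injective.2 (add_right_injective s)) hxy
  rw [e, finsum_mem_image hinj, finsum_mem_eq_finite_toFinset_sum _ (CF_finite hc)]
  refine Finset.sum_congr rfl fun k hk => ?_
  have hk' : CF c k := by simpa using hk
  rw [affine_mem (hk'.zero hc), suppCone_image hQ hc hk' s (qp_spec hQ _)]
  rfl

end master

end MuAux

namespace MuAux

section vanish
variable {d : ℕ} {Λ : AddSubgroup (Vd d)} {Q : Vd d →ₗ[ℝ] Vd d →ₗ[ℝ] ℝ}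
  {I S μ : AddSubgroup (Vd d) → Set (Vd d) → Vd d → ℝ}

local notation "tr(" s "," c ")" => Set.image (fun y => s + y) c

lemma S_formula {Λ' : AddSubgroup (Vd d)} (hD : Disc Λ') {S' : Set (Vd d) → Vd d → ℝ}
    (hS : IsSMap Λ' S') {s : Vd d} {c : Set (Vd d)} (hs : IsRatPoint Λ' s) (hc : IsRatCone Λ' c)
    {ξ : Vd d} (hξ : ξ ∈ Uc c) :
    S' (tr(s,c)) ξ = ∑' x : ↥((tr(s,c)) ∩ (Λ' : Set (Vd d))), Real.exp (pairE ξ (x : Vd d)) :=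
  hS.2.2 _ (affCone_polyhedron hD hs hc) ξ (summable_cone hD hξ)

lemma mt_hyp (hQ : IsRatInner Λ Q) {Λ' : AddSubgroup (Vd d)} (hq : IsQuotLattice Q Λ Λ')
    {s : Vd d} {c k : Set (Vd d)} (hs : IsRatPoint Λ' s) (hc : IsRatCone Λ' c) (hk : CF c k) :
    IsQuotLattice Q Λ (ql Q Λ' k) ∧ IsRatPoint (ql Q Λ' k) (qp Q (Submodule.span ℝ k) s) ∧
    IsRatCone (ql Q Λ' k) (qp Q (Submodule.span ℝ k) '' c) ∧
    (Uc (qp Q (Submodule.span ℝ k) '' c)).Nonempty :=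
  ⟨ql_quot hQ hq (hk.cone hc), ratPoint_map hs _, cone_map hc _, hk.transverse_pointed hQ hc⟩

lemma ql_rank (hQ : IsRatInner Λ Q) {Λ' : AddSubgroup (Vd d)}
    {c k : Set (Vd d)} (hc : IsRatCone Λ' c) (hk : CF c k) (hne : k ≠ {0}) :
    Module.finrank ℝ (Submodule.span ℝ (ql Q Λ' k : Set (Vd d))) <
    Module.finrank ℝ (Submodule.span ℝ (Λ' : Set (Vd d))) :=
  rank_drop hQ _ (hk.span_le hc) (span_ne_bot (hk.zero hc) hne)

theorem vanish (hΛ : IsFullLattice Λ) (hQ : IsRatInner Λ Q)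
    (hI : IsIFamily Q Λ I) (hS : IsSFamily Q Λ S) (hμ : IsMuFamily Λ Q I S μ) (N : ℕ) :
    ∀ Λ' : AddSubgroup (Vd d), Module.finrank ℝ (Submodule.span ℝ (Λ' : Set (Vd d))) < N →
      IsQuotLattice Q Λ Λ' → ∀ (s : Vd d) (c : Set (Vd d)), IsRatPoint Λ' s → IsRatCone Λ' c →
      (Uc c).Nonempty → (∀ x ∈ Λ', x - s ∉ Submodule.span ℝ c) →
      MeroEqAt0 (μ Λ' (tr(s,c))) (fun _ => 0) := by
  induction N with
  | zero => intro Λ' h; omega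
  | succ N ih =>
    intro Λ' hN hq s c hs hc hU hx
    have hD := disc_quot hΛ hQ hq
    have hm := master hQ hμ hq hs hc hU
    have hSz : ∀ ξ, S Λ' (tr(s,c)) ξ = 0 := by
      intro ξ
      have hemp : IsEmpty ↥((tr(s,c)) ∩ (Λ' : Set (Vd d))) := by
        refine ⟨?_⟩
        rintro ⟨_, ⟨y, hy, rfl⟩, hΛy⟩
        refine hx _ hΛy ?_
        simpa using Submodule.subset_span hy
      rw [(hS Λ' hq).2.2 _ (affCone_polyhedron hD hs hc) ξ (Summable.of_finite), tsum_empty]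
    rw [← mt_vertex (μ := μ) hQ s c]
    refine meroEq_cancel (CF_finite hc).toFinset (A := fun k => mt Q μ Λ' s c k)
      (B := fun _ _ => 0) (c := fun k => I Λ' (tr(s,k))) {0} ?_ ?_ ?_ ?_
    · simpa using CF_vertex hc hU
    · refine meroEq_trans (meroEq_symm hm) (meroEq_of_eq fun ξ => ?_)
      rw [hSz]; simp
    · intro k hk hk0
      have hk' : CF c k := by simpa using hk
      obtain ⟨h1, h2, h3, h4⟩ := mt_hyp hQ hq hs hc hk'
      refine ih _ ?_ h1 _ _ h2 h3 h4 ?_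
      · have := ql_rank hQ hc hk' hk0
        omega
      · rintro _ ⟨x, hxΛ, rfl⟩ hmem
        apply hx x hxΛ
        rw [← Submodule.map_span] at hmem
        obtain ⟨w, hw, hwe⟩ := hmem
        have hsp := (qp_spec hQ (Submodule.span ℝ k)).1 (x - s - w)
        have hz : qp Q (Submodule.span ℝ k) (x - s - w) = 0 := by
          rw [map_sub, map_sub, hwe]
          exact sub_self _
        rw [hz, sub_zero] at hsp
        have := Submodule.add_mem _ (Submodule.span_mono hk'.sub hsp) hw
        simpa using this
    · intro ξ
      rw [I_vertex hD (hI Λ' hq) hs]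
      exact (Real.exp_pos _).ne'

end vanish

section transform
variable {d : ℕ} {Λ : AddSubgroup (Vd d)} {Q : Vd d →ₗ[ℝ] Vd d →ₗ[ℝ] ℝ}
  {I S μ : AddSubgroup (Vd d) → Set (Vd d) → Vd d → ℝ}

local notation "tr(" s "," c ")" => Set.image (fun y => s + y) c

lemma Uc_transform {g σ : Vd d ≃ₗ[ℝ] Vd d} (hσ : ∀ ξ x, pairE (σ ξ) (g x) = pairE ξ x)
    {c : Set (Vd d)} {ξ : Vd d} (h : ξ ∈ Uc c) : σ ξ ∈ Uc (g '' c) := by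
  obtain ⟨ε, hε, h⟩ := h
  let G : Vd d →L[ℝ] Vd d := LinearMap.toContinuousLinearMap (g : Vd d →ₗ[ℝ] Vd d)
  have hp : 0 < ‖G‖ + 1 := by positivity
  refine ⟨ε / (‖G‖ + 1), by positivity, ?_⟩
  rintro _ ⟨y, hy, rfl⟩
  rw [hσ]
  refine (h y hy).trans ?_
  have h1 : ‖g y‖ ≤ ‖G‖ * ‖y‖ := G.le_opNorm y
  have h2 : ‖g y‖ ≤ (‖G‖ + 1) * ‖y‖ := by nlinarith [norm_nonneg y]
  rw [neg_mul, neg_mul, neg_le_neg_iff, div_mul_eq_mul_div, div_le_iff₀ hp]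
  nlinarith

lemma CF_transform {g σ : Vd d ≃ₗ[ℝ] Vd d} (hσ : ∀ ξ x, pairE (σ ξ) (g x) = pairE ξ x)
    {c k : Set (Vd d)} (h : CF c k) : CF (g '' c) (g '' k) := by
  obtain ⟨φ, h1, rfl⟩ := h
  refine ⟨σ φ, ?_, ?_⟩
  · rintro _ ⟨y, hy, rfl⟩
    rw [hσ]; exact h1 y hy
  · ext x
    constructor
    · rintro ⟨y, ⟨hy, h0⟩, rfl⟩
      exact ⟨⟨y, hy, rfl⟩, by rw [hσ, h0]⟩
    · rintro ⟨⟨y, hy, rfl⟩, h0⟩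
      rw [hσ] at h0
      exact ⟨y, ⟨hy, h0⟩, rfl⟩

lemma CF_transform_inv {g σ : Vd d ≃ₗ[ℝ] Vd d} (hσ : ∀ ξ x, pairE (σ ξ) (g x) = pairE ξ x)
    {c k : Set (Vd d)} (h : CF (g '' c) k) : ∃ k', CF c k' ∧ k = g '' k' := by
  have := CF_transform (g := g.symm) (σ := σ.symm) (fun ξ x => by
    rw [← hσ]; simp) h
  refine ⟨g.symm '' k, ?_, ?_⟩
  · rw [image_image g.symm g] at this
    simpa using this
  · rw [image_image]; simp

lemma CF_finset_transform {g σ : Vd d ≃ₗ[ℝ] Vd d}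
    (hσ : ∀ ξ x, pairE (σ ξ) (g x) = pairE ξ x) {Λ1 Λ2 : AddSubgroup (Vd d)}
    {c : Set (Vd d)} (hc : IsRatCone Λ1 c) (hc2 : IsRatCone Λ2 (g '' c))
    (f : Set (Vd d) → ℝ) :
    ∑ k ∈ (CF_finite hc2).toFinset, f k = ∑ k ∈ (CF_finite hc).toFinset, f (g '' k) := by
  symm
  refine Finset.sum_bij (fun k _ => g '' k) ?_ ?_ ?_ ?_
  · intro k hk
    simp only [Finite.mem_toFinset, mem_ofPred_eq] at hk ⊢
    exact CF_transform hσ hk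
  · intro k _ k' _ h
    exact Set.image_injective.2 g.injective h
  · intro k hk
    simp only [Finite.mem_toFinset, mem_ofPred_eq] at hk
    obtain ⟨k', h1, h2⟩ := CF_transform_inv hσ hk
    exact ⟨k', by simpa using h1, h2.symm⟩
  · intros; rfl

lemma S_transform (hD1 : Disc Λ) {Λ2 : AddSubgroup (Vd d)} (hD2 : Disc Λ2)
    {S1 S2 : Set (Vd d) → Vd d → ℝ} (hS1 : IsSMap Λ S1) (hS2 : IsSMap Λ2 S2)
    {g σ : Vd d ≃ₗ[ℝ] Vd d} (hσ : ∀ ξ x, pairE (σ ξ) (g x) = pairE ξ x)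
    (hg : ∀ y, y ∈ Λ ↔ g y ∈ Λ2) {x : Vd d} (hx : x ∈ Λ2) {s : Vd d} {c : Set (Vd d)}
    (hs : IsRatPoint Λ s) (hc : IsRatCone Λ c) (hs2 : IsRatPoint Λ2 (x + g s))
    (hc2 : IsRatCone Λ2 (g '' c)) (hU : (Uc c).Nonempty) :
    MeroEqAt0 (fun ξ => S2 (tr(x + g s,g '' c)) (σ ξ))
      (fun ξ => Real.exp (pairE (σ ξ) x) * S1 (tr(s,c)) ξ) := by
  refine Mero.eq_of_cone ?_ ?_ (Uc c) (Uc_open c) hU (Uc_smul c) ?_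
  · exact (Mero.of_rat (hS2.1 _ (affCone_polyhedron hD2 hs2 hc2))).comp σ
  · exact ((Mero.of_analytic (analytic_exp x)).comp σ).mul
      (Mero.of_rat (hS1.1 _ (affCone_polyhedron hD1 hs hc)))
  · intro ξ hξ
    rw [S_formula hD2 hS2 hs2 hc2 (Uc_transform hσ hξ), S_formula hD1 hS1 hs hc hξ,
      ← tsum_mul_left]
    have e : (tr(x + g s,g '' c)) ∩ (Λ2 : Set (Vd d)) =
        (fun y => x + g y) '' ((tr(s,c)) ∩ (Λ : Set (Vd d))) := by
      ext z
      constructor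
      · rintro ⟨⟨_, ⟨y, hy, rfl⟩, rfl⟩, hz⟩
        refine ⟨s + y, ⟨⟨y, hy, rfl⟩, ?_⟩, ?_⟩
        · have := Λ2.sub_mem hz hx
          rw [SetLike.mem_coe, hg, map_add]
          convert this using 1
          simp only [add_assoc, add_sub_cancel_left]
        · simp only [map_add]; abel
      · rintro ⟨_, ⟨⟨y, hy, rfl⟩, hz⟩, rfl⟩
        refine ⟨⟨g y, ⟨y, hy, rfl⟩, ?_⟩, Λ2.add_mem hx ((hg _).1 hz)⟩
        simp only [map_add]; abel
    rw [e, tsum_image (fun z : Vd d => Real.exp (pairE (σ ξ) z))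
      (fun y _ z _ h => g.injective (add_left_cancel h))]
    refine tsum_congr fun y => ?_
    rw [pairE_add, Real.exp_add, hσ]

lemma I_transform (hD1 : Disc Λ) {Λ2 : AddSubgroup (Vd d)} (hD2 : Disc Λ2)
    {S1 S2 : Set (Vd d) → Vd d → ℝ} (hS1 : IsIMap Λ S1) (hS2 : IsIMap Λ2 S2)
    {g σ : Vd d ≃ₗ[ℝ] Vd d} (hσ : ∀ ξ x, pairE (σ ξ) (g x) = pairE ξ x)
    (hg : ∀ y, y ∈ Λ ↔ g y ∈ Λ2) {x : Vd d} {s : Vd d} {c : Set (Vd d)}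
    (hs : IsRatPoint Λ s) (hc : IsRatCone Λ c) (hs2 : IsRatPoint Λ2 (x + g s))
    (hc2 : IsRatCone Λ2 (g '' c)) (hU : (Uc c).Nonempty) :
    MeroEqAt0 (fun ξ => S2 (tr(x + g s,g '' c)) (σ ξ))
      (fun ξ => Real.exp (pairE (σ ξ) x) * S1 (tr(s,c)) ξ) := by
  refine Mero.eq_of_cone ?_ ?_ (Uc c) (Uc_open c) hU (Uc_smul c) ?_
  · exact (Mero.of_rat (hS2.1 _ (affCone_polyhedron hD2 hs2 hc2))).comp σ
  · exact ((Mero.of_analytic (analytic_exp x)).comp σ).mul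
      (Mero.of_rat (hS1.1 _ (affCone_polyhedron hD1 hs hc)))
  · intro ξ hξ
    obtain ⟨n, v, hv⟩ := exists_LB hD1 hc
    have hv2 : LB Λ2 (Submodule.span ℝ (g '' c)) (fun i => g (v i)) := by
      refine ⟨hv.li.map' (g : Vd d →ₗ[ℝ] Vd d) g.ker, fun i => (hg _).1 (hv.mem i), ?_, ?_⟩
      · have h1 : Set.range (fun i => g (v i)) = (g : Vd d →ₗ[ℝ] Vd d) '' Set.range v := by
          rw [← Set.range_comp]; rfl
        have h2 : (g '' c) = (g : Vd d →ₗ[ℝ] Vd d) '' c := rfl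
        rw [h1, h2, ← Submodule.map_span, ← Submodule.map_span, hv.span]
      · intro y hy hys
        have h2 : (g '' c) = (g : Vd d →ₗ[ℝ] Vd d) '' c := rfl
        rw [h2, ← Submodule.map_span] at hys
        obtain ⟨z, hz, rfl⟩ := hys
        obtain ⟨t, rfl⟩ := hv.rep z ((hg z).2 hy) hz
        exact ⟨t, by simp⟩
    rw [I_formula hD2 hS2 hs2 hc2 hv2 (Uc_transform hσ hξ), I_formula hD1 hS1 hs hc hv hξ,
      pairE_add, Real.exp_add, hσ, mul_assoc]
    congr 2
    unfold Jint
    have e : ∀ t : Fin n → ℝ, ∑ i, t i • g (v i) = g (∑ i, t i • v i) := fun t => by simp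
    simp only [e, hσ, g.injective.mem_set_image]

theorem transform (hΛ : IsFullLattice Λ) (hQ : IsRatInner Λ Q)
    (hI : IsIFamily Q Λ I) (hS : IsSFamily Q Λ S) (hμ : IsMuFamily Λ Q I S μ)
    (g σ : Vd d ≃ₗ[ℝ] Vd d) (hσ : ∀ ξ x, pairE (σ ξ) (g x) = pairE ξ x) (N : ℕ) :
    ∀ Λ1 Λ2 : AddSubgroup (Vd d),
      Module.finrank ℝ (Submodule.span ℝ (Λ1 : Set (Vd d))) < N →
      IsQuotLattice Q Λ Λ1 → IsQuotLattice Q Λ Λ2 →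
      (∀ x ∈ Submodule.span ℝ (Λ1 : Set (Vd d)), ∀ y ∈ Submodule.span ℝ (Λ1 : Set (Vd d)),
          Q (g x) (g y) = Q x y) →
      AddSubgroup.map (g : Vd d →ₗ[ℝ] Vd d).toAddMonoidHom Λ1 = Λ2 →
      ∀ (x s : Vd d) (c : Set (Vd d)), x ∈ Λ2 → IsRatPoint Λ1 s → IsRatCone Λ1 c →
      (Uc c).Nonempty →
      MeroEqAt0 (fun ξ => μ Λ2 (tr(x + g s,g '' c)) (σ ξ)) (μ Λ1 (tr(s,c))) := by
  induction N with
  | zero => intro Λ1 Λ2 h; omega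
  | succ N ih =>
    intro Λ1 Λ2 hN hq1 hq2 hiso hmap x s c hx hs hc hU
    have hD1 := disc_quot hΛ hQ hq1
    have hD2 := disc_quot hΛ hQ hq2
    have hg : ∀ y, y ∈ Λ1 ↔ g y ∈ Λ2 := by
      intro y
      rw [← hmap]
      constructor
      · exact fun h => ⟨y, h, rfl⟩
      · rintro ⟨z, hz, hzy⟩
        have : z = y := g.injective hzy
        exact this ▸ hz
    have hc' : ∀ {k : Set (Vd d)}, IsRatCone Λ1 k → IsRatCone Λ2 (g '' k) := by
      intro k hk
      rw [← hmap]; exact cone_map hk (g : Vd d →ₗ[ℝ] Vd d)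
    have hc2 := hc' hc
    have hs2 : IsRatPoint Λ2 (x + g s) := by
      refine ratPoint_add (ratPoint_of_mem hx) ?_
      rw [← hmap]; exact ratPoint_map hs (g : Vd d →ₗ[ℝ] Vd d)
    have hU2 : (Uc (g '' c)).Nonempty := hU.imp' σ fun ξ h => Uc_transform hσ h
    have hm1 := master hQ hμ hq1 hs hc hU
    have hm2 := meroEq_comp (master hQ hμ hq2 hs2 hc2 hU2) σ
    have hST := S_transform hD1 hD2 (hS _ hq1) (hS _ hq2) hσ hg hx hs hc hs2 hc2 hU
    have hIT : ∀ k, CF c k → MeroEqAt0 (fun ξ => I Λ2 (tr(x + g s,g '' k)) (σ ξ))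
        (fun ξ => Real.exp (pairE (σ ξ) x) * I Λ1 (tr(s,k)) ξ) := fun k hk =>
      I_transform hD1 hD2 (hI _ hq1) (hI _ hq2) hσ hg hs (hk.cone hc) hs2 (hc' (hk.cone hc))
        (hU.mono (Uc_mono hk.sub))
    have hv1 := mt_vertex (μ := μ) (Λ' := Λ1) hQ s c
    have hv2 := mt_vertex (μ := μ) (Λ' := Λ2) hQ (x + g s) (g '' c)
    rw [← hv1, ← hv2]
    have key := meroEq_cancel (CF_finite hc).toFinset
      (A := fun k ξ => mt Q μ Λ2 (x + g s) (g '' c) (g '' k) (σ ξ))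
      (B := fun k => mt Q μ Λ1 s c k)
      (c := fun k ξ => Real.exp (pairE (σ ξ) x) * I Λ1 (tr(s,k)) ξ) {0} ?_ ?_ ?_ ?_
    · simpa using key
    · simpa using CF_vertex hc hU
    · have h1 : MeroEqAt0 (fun ξ => ∑ k ∈ (CF_finite hc).toFinset,
          mt Q μ Λ2 (x + g s) (g '' c) (g '' k) (σ ξ) *
            (Real.exp (pairE (σ ξ) x) * I Λ1 (tr(s,k)) ξ))
          (fun ξ => ∑ k ∈ (CF_finite hc).toFinset,
            mt Q μ Λ2 (x + g s) (g '' c) (g '' k) (σ ξ) * I Λ2 (tr(x + g s,g '' k)) (σ ξ)) := by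
        refine meroEq_sum _ fun k hk => ?_
        have hk' : CF c k := by simpa using hk
        exact meroEq_mul (meroEq_refl _) (meroEq_symm (hIT k hk'))
      refine meroEq_trans h1 ?_
      have h2 : MeroEqAt0 (fun ξ => ∑ k ∈ (CF_finite hc).toFinset,
            mt Q μ Λ2 (x + g s) (g '' c) (g '' k) (σ ξ) * I Λ2 (tr(x + g s,g '' k)) (σ ξ))
          (fun ξ => S Λ2 (tr(x + g s,g '' c)) (σ ξ)) := by
        refine meroEq_trans (meroEq_of_eq fun ξ => ?_) (meroEq_symm hm2)
        exact (CF_finset_transform hσ hc hc2 (fun k =>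
          mt Q μ Λ2 (x + g s) (g '' c) k (σ ξ) * I Λ2 (tr(x + g s,k)) (σ ξ))).symm
      refine meroEq_trans h2 (meroEq_trans hST ?_)
      refine meroEq_trans (meroEq_mul (meroEq_refl _) hm1) (meroEq_of_eq fun ξ => ?_)
      rw [Finset.mul_sum]
      exact Finset.sum_congr rfl fun k _ => by ring
    · intro k hk hk0
      have hk' : CF c k := by simpa using hk
      obtain ⟨h1, h2, h3, h4⟩ := mt_hyp hQ hq1 hs hc hk'
      obtain ⟨h1', -, -, -⟩ := mt_hyp hQ hq2 hs2 hc2 (CF_transform hσ hk')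
      set L := Submodule.span ℝ k with hL
      have hL2 : Submodule.span ℝ (g '' k) = Submodule.map (g : Vd d →ₗ[ℝ] Vd d) L := by
        rw [hL, Submodule.map_span]; rfl
      have hLW : L ≤ Submodule.span ℝ (Λ1 : Set (Vd d)) := hk'.span_le hc
      have hcomm : ∀ y ∈ Submodule.span ℝ (Λ1 : Set (Vd d)),
          qp Q (Submodule.span ℝ (g '' k)) (g y) = g (qp Q L y) := by
        intro y hy
        refine coproj_unique hQ (qp_spec hQ _) ?_ ?_
        · rw [hL2, ← map_sub]
          exact ⟨_, (qp_spec hQ L).1 y, rfl⟩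
        · intro l hl
          rw [hL2] at hl
          obtain ⟨l', hl', rfl⟩ := hl
          have := hiso _ (qp_mem hQ hLW hy) _ (hLW hl')
          exact this.trans ((qp_spec hQ L).2 y l' hl')
      have hsub : ∀ y ∈ Submodule.span ℝ (ql Q Λ1 k : Set (Vd d)),
          y ∈ Submodule.span ℝ (Λ1 : Set (Vd d)) := by
        intro y hy
        rw [ql, span_map] at hy
        obtain ⟨z, hz, rfl⟩ := hy
        exact qp_mem hQ hLW hz
      have hmapk : AddSubgroup.map (g : Vd d →ₗ[ℝ] Vd d).toAddMonoidHom (ql Q Λ1 k)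
          = ql Q Λ2 (g '' k) := by
        ext z
        constructor
        · rintro ⟨_, ⟨y, hy, rfl⟩, rfl⟩
          exact ⟨g y, (hg y).1 hy, hcomm y (Submodule.subset_span hy)⟩
        · rintro ⟨_, hy, rfl⟩
          rw [← hmap] at hy
          obtain ⟨y, hy, rfl⟩ := hy
          exact ⟨_, ⟨y, hy, rfl⟩, (hcomm y (Submodule.subset_span hy)).symm⟩
      have := ih (ql Q Λ1 k) (ql Q Λ2 (g '' k))
        (by have := ql_rank hQ hc hk' hk0; omega) h1 h1'
        (fun a ha b hb => hiso a (hsub a ha) b (hsub b hb)) hmapk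
        (qp Q (Submodule.span ℝ (g '' k)) x) _ _ ⟨x, hx, rfl⟩ h2 h3 h4
      have e1 : qp Q (Submodule.span ℝ (g '' k)) (x + g s) =
          qp Q (Submodule.span ℝ (g '' k)) x + g (qp Q L s) := by
        rw [map_add, hcomm s (ratPoint_span hs)]
      have e2 : qp Q (Submodule.span ℝ (g '' k)) '' (g '' c) = g '' (qp Q L '' c) := by
        rw [image_image, image_image]
        exact image_congr fun y hy => hcomm y (cone_span hc hy)
      simp only [mt, e1, e2]
      exact this
    · intro ξ
      rw [I_vertex hD1 (hI Λ1 hq1) hs]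
      positivity

end transform

end MuAux

namespace MuAux

section split
variable {d : ℕ} {Λ : AddSubgroup (Vd d)} {Q : Vd d →ₗ[ℝ] Vd d →ₗ[ℝ] ℝ}

local notation "tr(" s "," c ")" => Set.image (fun y => s + y) c

/-- projections attached to two independent subspaces -/
structure Spl (W1 W2 : Submodule ℝ (Vd d)) (p1 p2 : Vd d →ₗ[ℝ] Vd d) : Prop where
  a1 : ∀ y ∈ W1, p1 y = y
  b1 : ∀ y ∈ W2, p1 y = 0
  a2 : ∀ y ∈ W2, p2 y = y
  b2 : ∀ y ∈ W1, p2 y = 0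

lemma exists_spl (hQ : IsRatInner Λ Q) {W1 W2 : Submodule ℝ (Vd d)}
    (h : ∀ x ∈ W1, ∀ y ∈ W2, Q x y = 0) : Spl W1 W2 (qp Q W2) (qp Q W1) where
  a1 y hy := coproj_unique hQ (qp_spec hQ _) (by simp) (fun l hl => h y hy l hl)
  b1 y hy := coproj_kill hQ (qp_spec hQ _) hy
  a2 y hy := coproj_unique hQ (qp_spec hQ _) (by simp) (fun l hl => by rw [hQ.1]; exact h l hl y hy)
  b2 y hy := coproj_kill hQ (qp_spec hQ _) hy

variable {W1 W2 : Submodule ℝ (Vd d)} {p1 p2 : Vd d →ₗ[ℝ] Vd d}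

lemma Spl.fst (h : Spl W1 W2 p1 p2) {x y : Vd d} (hx : x ∈ W1) (hy : y ∈ W2) : p1 (x + y) = x := by
  rw [map_add, h.a1 x hx, h.b1 y hy, add_zero]

lemma Spl.snd (h : Spl W1 W2 p1 p2) {x y : Vd d} (hx : x ∈ W1) (hy : y ∈ W2) : p2 (x + y) = y := by
  rw [map_add, h.b2 x hx, h.a2 y hy, zero_add]

lemma Spl.inj (h : Spl W1 W2 p1 p2) {x y x' y' : Vd d} (hx : x ∈ W1) (hy : y ∈ W2) (hx' : x' ∈ W1)
    (hy' : y' ∈ W2) (he : x + y = x' + y') : x = x' ∧ y = y' := by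
  refine ⟨?_, ?_⟩
  · rw [← h.fst hx hy, he, h.fst hx' hy']
  · rw [← h.snd hx hy, he, h.snd hx' hy']

lemma Spl.glue (h : Spl W1 W2 p1 p2) (ξ1 ξ2 : Vd d) : ∃ ξ : Vd d,
    (∀ y ∈ W1, pairE ξ y = pairE ξ1 y) ∧ (∀ y ∈ W2, pairE ξ y = pairE ξ2 y) := by
  obtain ⟨ξ, hξ⟩ := exists_pairE ((innerₗ (Vd d) ξ1).comp p1 + (innerₗ (Vd d) ξ2).comp p2)
  refine ⟨ξ, fun y hy => ?_, fun y hy => ?_⟩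
  · rw [hξ]
    simp [h.a1 y hy, h.b2 y hy, pairE]
  · rw [hξ]
    simp [h.b1 y hy, h.a2 y hy, pairE]

variable {c1 c2 : Set (Vd d)}

lemma left_sub (h2 : (0 : Vd d) ∈ c2) : c1 ⊆ c1 + c2 := fun y hy => ⟨y, hy, 0, h2, by simp⟩
lemma right_sub (h1 : (0 : Vd d) ∈ c1) : c2 ⊆ c1 + c2 := fun y hy => ⟨0, h1, y, hy, by simp⟩

lemma Uc_sum (h : Spl W1 W2 p1 p2) (hc1 : c1 ⊆ W1) (hc2 : c2 ⊆ W2) (hU1 : (Uc c1).Nonempty)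
    (hU2 : (Uc c2).Nonempty) : (Uc (c1 + c2)).Nonempty := by
  obtain ⟨ξ1, ε1, hε1, h1⟩ := hU1
  obtain ⟨ξ2, ε2, hε2, h2⟩ := hU2
  obtain ⟨ξ, e1, e2⟩ := h.glue ξ1 ξ2
  refine ⟨ξ, min ε1 ε2, lt_min hε1 hε2, ?_⟩
  rintro _ ⟨y1, hy1, y2, hy2, rfl⟩
  simp only
  rw [pairE_add, e1 _ (hc1 hy1), e2 _ (hc2 hy2)]
  have a1 := h1 y1 hy1
  have a2 := h2 y2 hy2
  have b1 : min ε1 ε2 * ‖y1‖ ≤ ε1 * ‖y1‖ := mul_le_mul_of_nonneg_right (min_le_left _ _) (norm_nonneg _)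
  have b2 : min ε1 ε2 * ‖y2‖ ≤ ε2 * ‖y2‖ := mul_le_mul_of_nonneg_right (min_le_right _ _) (norm_nonneg _)
  have b3 : min ε1 ε2 * ‖y1 + y2‖ ≤ min ε1 ε2 * (‖y1‖ + ‖y2‖) :=
    mul_le_mul_of_nonneg_left (norm_add_le _ _) (lt_min hε1 hε2).le
  linarith

lemma CF_sum_mk (h : Spl W1 W2 p1 p2) (hc1 : c1 ⊆ W1) (hc2 : c2 ⊆ W2) {k1 k2 : Set (Vd d)}
    (h1 : CF c1 k1) (h2 : CF c2 k2) : CF (c1 + c2) (k1 + k2) := by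
  obtain ⟨φ1, f1, rfl⟩ := h1
  obtain ⟨φ2, f2, rfl⟩ := h2
  obtain ⟨φ, e1, e2⟩ := h.glue φ1 φ2
  refine ⟨φ, ?_, ?_⟩
  · rintro _ ⟨y1, hy1, y2, hy2, rfl⟩
    simp only
    rw [pairE_add, e1 _ (hc1 hy1), e2 _ (hc2 hy2)]
    linarith [f1 y1 hy1, f2 y2 hy2]
  · ext x
    constructor
    · rintro ⟨y1, ⟨hy1, z1⟩, y2, ⟨hy2, z2⟩, rfl⟩
      refine ⟨⟨y1, hy1, y2, hy2, rfl⟩, ?_⟩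
      simp only
      rw [pairE_add, e1 _ (hc1 hy1), e2 _ (hc2 hy2), z1, z2, add_zero]
    · rintro ⟨⟨y1, hy1, y2, hy2, rfl⟩, z⟩
      simp only at z
      rw [pairE_add, e1 _ (hc1 hy1), e2 _ (hc2 hy2)] at z
      have a1 := f1 y1 hy1
      have a2 := f2 y2 hy2
      exact ⟨y1, ⟨hy1, by linarith⟩, y2, ⟨hy2, by linarith⟩, rfl⟩

lemma CF_sum_split (h1 : (0 : Vd d) ∈ c1) (h2 : (0 : Vd d) ∈ c2) {k : Set (Vd d)}
    (h : CF (c1 + c2) k) : ∃ k1 k2, CF c1 k1 ∧ CF c2 k2 ∧ k = k1 + k2 := by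
  obtain ⟨φ, f, rfl⟩ := h
  have f1 : ∀ y ∈ c1, pairE φ y ≤ 0 := fun y hy => f y (left_sub h2 hy)
  have f2 : ∀ y ∈ c2, pairE φ y ≤ 0 := fun y hy => f y (right_sub h1 hy)
  refine ⟨_, _, ⟨φ, f1, rfl⟩, ⟨φ, f2, rfl⟩, ?_⟩
  ext x
  constructor
  · rintro ⟨⟨y1, hy1, y2, hy2, rfl⟩, z⟩
    simp only at z
    rw [pairE_add] at z
    have a1 := f1 y1 hy1
    have a2 := f2 y2 hy2
    exact ⟨y1, ⟨hy1, by linarith⟩, y2, ⟨hy2, by linarith⟩, rfl⟩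
  · rintro ⟨y1, ⟨hy1, z1⟩, y2, ⟨hy2, z2⟩, rfl⟩
    refine ⟨⟨y1, hy1, y2, hy2, rfl⟩, ?_⟩
    simp only
    rw [pairE_add, z1, z2, add_zero]

lemma Spl.fst_image (h : Spl W1 W2 p1 p2) {k1 k2 : Set (Vd d)} (h1 : k1 ⊆ W1) (h2 : k2 ⊆ W2)
    (z2 : (0 : Vd d) ∈ k2) : p1 '' (k1 + k2) = k1 := by
  ext x
  constructor
  · rintro ⟨_, ⟨y1, hy1, y2, hy2, rfl⟩, rfl⟩
    simp only
    rwa [h.fst (h1 hy1) (h2 hy2)]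
  · intro hx
    exact ⟨x, left_sub z2 hx, h.a1 x (h1 hx)⟩

lemma Spl.snd_image (h : Spl W1 W2 p1 p2) {k1 k2 : Set (Vd d)} (h1 : k1 ⊆ W1) (h2 : k2 ⊆ W2)
    (z1 : (0 : Vd d) ∈ k1) : p2 '' (k1 + k2) = k2 := by
  ext x
  constructor
  · rintro ⟨_, ⟨y1, hy1, y2, hy2, rfl⟩, rfl⟩
    simp only
    rwa [h.snd (h1 hy1) (h2 hy2)]
  · intro hx
    exact ⟨x, right_sub z1 hx, h.a2 x (h2 hx)⟩

lemma CF_finset_sum (h : Spl W1 W2 p1 p2) (hc1 : c1 ⊆ W1) (hc2 : c2 ⊆ W2)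
    {Λ1 Λ2 Λ3 : AddSubgroup (Vd d)} (r1 : IsRatCone Λ1 c1) (r2 : IsRatCone Λ2 c2)
    (r : IsRatCone Λ3 (c1 + c2)) (f : Set (Vd d) → ℝ) :
    ∑ k ∈ (CF_finite r).toFinset, f k =
      ∑ p ∈ (CF_finite r1).toFinset ×ˢ (CF_finite r2).toFinset, f (p.1 + p.2) := by
  symm
  refine Finset.sum_bij (fun p _ => p.1 + p.2) ?_ ?_ ?_ ?_
  · intro p hp
    simp only [Finset.mem_product, Finite.mem_toFinset, mem_ofPred_eq] at hp ⊢
    exact CF_sum_mk h hc1 hc2 hp.1 hp.2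
  · intro p hp q hq he
    simp only [Finset.mem_product, Finite.mem_toFinset, mem_ofPred_eq] at hp hq
    have a1 := hp.1.sub.trans hc1
    have a2 := hp.2.sub.trans hc2
    have b1 := hq.1.sub.trans hc1
    have b2 := hq.2.sub.trans hc2
    refine Prod.ext ?_ ?_
    · rw [← h.fst_image a1 a2 (hp.2.zero r2), he, h.fst_image b1 b2 (hq.2.zero r2)]
    · rw [← h.snd_image a1 a2 (hp.1.zero r1), he, h.snd_image b1 b2 (hq.1.zero r1)]
  · intro k hk
    simp only [Finite.mem_toFinset, mem_ofPred_eq] at hk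
    obtain ⟨k1, k2, h1, h2, rfl⟩ := CF_sum_split (cone_zero r1) (cone_zero r2) hk
    exact ⟨(k1, k2), by simp [h1, h2], rfl⟩
  · intros; rfl

lemma span_add_set (h1 : (0 : Vd d) ∈ c1) (h2 : (0 : Vd d) ∈ c2) :
    Submodule.span ℝ (c1 + c2) = Submodule.span ℝ c1 ⊔ Submodule.span ℝ c2 := by
  apply le_antisymm
  · refine Submodule.span_le.2 ?_
    rintro _ ⟨y1, hy1, y2, hy2, rfl⟩
    exact Submodule.add_mem_sup (Submodule.subset_span hy1) (Submodule.subset_span hy2)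
  · exact sup_le (Submodule.span_mono (left_sub h2)) (Submodule.span_mono (right_sub h1))

end split

section mult
variable {d : ℕ} {Λ : AddSubgroup (Vd d)} {Q : Vd d →ₗ[ℝ] Vd d →ₗ[ℝ] ℝ}
  {I S μ : AddSubgroup (Vd d) → Set (Vd d) → Vd d → ℝ}
  {Λ1 Λ2 : AddSubgroup (Vd d)} {p1 p2 : Vd d →ₗ[ℝ] Vd d} {c1 c2 : Set (Vd d)} {s1 s2 : Vd d}

local notation "tr(" s "," c ")" => Set.image (fun y => s + y) c

lemma tr_span (hs : IsRatPoint Λ s1) (hc : IsRatCone Λ c1) :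
    tr(s1,c1) ⊆ Submodule.span ℝ (Λ : Set (Vd d)) := by
  rintro _ ⟨y, hy, rfl⟩
  exact Submodule.add_mem _ (ratPoint_span hs) (cone_span hc hy)

lemma S_mult (h : Spl (Submodule.span ℝ (Λ1 : Set (Vd d))) (Submodule.span ℝ (Λ2 : Set (Vd d))) p1 p2)
    (hD1 : Disc Λ1) (hD2 : Disc Λ2) (hD : Disc (Λ1 ⊔ Λ2))
    {S1 S2 S3 : Set (Vd d) → Vd d → ℝ} (hS1 : IsSMap Λ1 S1) (hS2 : IsSMap Λ2 S2)
    (hS : IsSMap (Λ1 ⊔ Λ2) S3) (hs1 : IsRatPoint Λ1 s1) (hs2 : IsRatPoint Λ2 s2)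
    (r1 : IsRatCone Λ1 c1) (r2 : IsRatCone Λ2 c2) (hU : (Uc (c1 + c2)).Nonempty) :
    MeroEqAt0 (S3 (tr((s1 + s2),(c1 + c2)))) (fun ξ => S1 (tr(s1,c1)) ξ * S2 (tr(s2,c2)) ξ) := by
  have r := cone_sum (cone_mono (le_sup_left : Λ1 ≤ Λ1 ⊔ Λ2) r1) (cone_mono le_sup_right r2)
  have hs := ratPoint_add (ratPoint_mono (le_sup_left : Λ1 ≤ Λ1 ⊔ Λ2) hs1) (ratPoint_mono le_sup_right hs2)
  refine Mero.eq_of_cone ?_ ?_ _ (Uc_open _) hU (Uc_smul _) ?_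
  · exact Mero.of_rat (hS.1 _ (affCone_polyhedron hD hs r))
  · exact (Mero.of_rat (hS1.1 _ (affCone_polyhedron hD1 hs1 r1))).mul
      (Mero.of_rat (hS2.1 _ (affCone_polyhedron hD2 hs2 r2)))
  · intro ξ hξ
    have hξ1 := Uc_mono (left_sub (c1 := c1) (cone_zero r2)) hξ
    have hξ2 := Uc_mono (right_sub (c2 := c2) (cone_zero r1)) hξ
    rw [S_formula hD hS hs r hξ, S_formula hD1 hS1 hs1 r1 hξ1, S_formula hD2 hS2 hs2 r2 hξ2,
      tsum_mul_tsum_of_summable_norm (summable_cone hD1 hξ1).norm (summable_cone hD2 hξ2).norm]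
    have t1 := tr_span hs1 r1
    have t2 := tr_span hs2 r2
    let f : ↥((tr(s1,c1)) ∩ (Λ1 : Set (Vd d))) × ↥((tr(s2,c2)) ∩ (Λ2 : Set (Vd d))) →
        ↥((tr((s1 + s2),(c1 + c2))) ∩ ((Λ1 ⊔ Λ2 : AddSubgroup (Vd d)) : Set (Vd d))) := fun z =>
      ⟨z.1 + z.2, by
        rw [← affSum_eq]
        exact ⟨_, z.1.2.1, _, z.2.2.1, rfl⟩, AddSubgroup.add_mem_sup z.1.2.2 z.2.2.2⟩
    have hf : Function.Bijective f := by
      constructor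
      · intro z w hzw
        have e : (z.1 : Vd d) + z.2 = w.1 + w.2 := congrArg Subtype.val hzw
        have := h.inj (t1 z.1.2.1) (t2 z.2.2.1) (t1 w.1.2.1) (t2 w.2.2.1) e
        exact Prod.ext (Subtype.ext this.1) (Subtype.ext this.2)
      · rintro ⟨x, hx, hxΛ⟩
        have hx' := hx
        rw [← affSum_eq] at hx'
        obtain ⟨x1, hx1, x2, hx2, hxe⟩ := hx'
        obtain ⟨l1, hl1, l2, hl2, hle⟩ := AddSubgroup.mem_sup.1 hxΛ
        have := h.inj (t1 hx1) (t2 hx2) (Submodule.subset_span hl1) (Submodule.subset_span hl2)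
          (hxe.trans hle.symm)
        refine ⟨⟨⟨x1, hx1, ?_⟩, ⟨x2, hx2, ?_⟩⟩, Subtype.ext hxe⟩
        · rw [this.1]; exact hl1
        · rw [this.2]; exact hl2
    rw [← (Equiv.ofBijective f hf).tsum_eq]
    refine tsum_congr fun z => ?_
    rw [← Real.exp_add, ← pairE_add]
    rfl

lemma I_mult (h : Spl (Submodule.span ℝ (Λ1 : Set (Vd d))) (Submodule.span ℝ (Λ2 : Set (Vd d))) p1 p2)
    (hD1 : Disc Λ1) (hD2 : Disc Λ2) (hD : Disc (Λ1 ⊔ Λ2))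
    {S1 S2 S3 : Set (Vd d) → Vd d → ℝ} (hS1 : IsIMap Λ1 S1) (hS2 : IsIMap Λ2 S2)
    (hS : IsIMap (Λ1 ⊔ Λ2) S3) (hs1 : IsRatPoint Λ1 s1) (hs2 : IsRatPoint Λ2 s2)
    (r1 : IsRatCone Λ1 c1) (r2 : IsRatCone Λ2 c2) (hU : (Uc (c1 + c2)).Nonempty) :
    MeroEqAt0 (S3 (tr((s1 + s2),(c1 + c2)))) (fun ξ => S1 (tr(s1,c1)) ξ * S2 (tr(s2,c2)) ξ) := by
  have r := cone_sum (cone_mono (le_sup_left : Λ1 ≤ Λ1 ⊔ Λ2) r1) (cone_mono le_sup_right r2)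
  have hs := ratPoint_add (ratPoint_mono (le_sup_left : Λ1 ≤ Λ1 ⊔ Λ2) hs1) (ratPoint_mono le_sup_right hs2)
  refine Mero.eq_of_cone ?_ ?_ _ (Uc_open _) hU (Uc_smul _) ?_
  · exact Mero.of_rat (hS.1 _ (affCone_polyhedron hD hs r))
  · exact (Mero.of_rat (hS1.1 _ (affCone_polyhedron hD1 hs1 r1))).mul
      (Mero.of_rat (hS2.1 _ (affCone_polyhedron hD2 hs2 r2)))
  · intro ξ hξ
    have hξ1 := Uc_mono (left_sub (c1 := c1) (cone_zero r2)) hξ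
    have hξ2 := Uc_mono (right_sub (c2 := c2) (cone_zero r1)) hξ
    obtain ⟨n1, v1, hv1⟩ := exists_LB hD1 r1
    obtain ⟨n2, v2, hv2⟩ := exists_LB hD2 r2
    have g1 : Submodule.span ℝ c1 ≤ Submodule.span ℝ (Λ1 : Set (Vd d)) :=
      Submodule.span_le.2 (cone_span r1)
    have g2 : Submodule.span ℝ c2 ≤ Submodule.span ℝ (Λ2 : Set (Vd d)) :=
      Submodule.span_le.2 (cone_span r2)
    have hv : LB (Λ1 ⊔ Λ2) (Submodule.span ℝ (c1 + c2)) (Sum.elim v1 v2) := by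
      refine ⟨?_, ?_, ?_, ?_⟩
      · refine hv1.li.sum_type hv2.li ?_
        rw [hv1.span, hv2.span, Submodule.disjoint_def]
        intro x hx1 hx2
        rw [← h.a1 x (g1 hx1), h.b1 x (g2 hx2)]
      · rintro (i | i)
        · exact (le_sup_left : Λ1 ≤ Λ1 ⊔ Λ2) (hv1.mem i)
        · exact (le_sup_right : Λ2 ≤ Λ1 ⊔ Λ2) (hv2.mem i)
      · rw [Set.Sum.elim_range, Submodule.span_union, hv1.span, hv2.span,
          span_add_set (cone_zero r1) (cone_zero r2)]
      · intro y hy hyL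
        rw [span_add_set (cone_zero r1) (cone_zero r2)] at hyL
        obtain ⟨w1, hw1, w2, hw2, rfl⟩ := Submodule.mem_sup.1 hyL
        obtain ⟨l1, hl1, l2, hl2, hle⟩ := AddSubgroup.mem_sup.1 hy
        obtain ⟨e1, e2⟩ := h.inj (g1 hw1) (g2 hw2) (Submodule.subset_span hl1)
          (Submodule.subset_span hl2) hle.symm
        obtain ⟨t1, ht1⟩ := hv1.rep w1 (by rw [e1]; exact hl1) hw1
        obtain ⟨t2, ht2⟩ := hv2.rep w2 (by rw [e2]; exact hl2) hw2
        refine ⟨Sum.elim t1 t2, ?_⟩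
        rw [Fintype.sum_sum_type]
        simp only [Sum.elim_inl, Sum.elim_inr]
        rw [← ht1, ← ht2]
    rw [I_formula hD hS hs r hv hξ, I_formula hD1 hS1 hs1 r1 hv1 hξ1,
      I_formula hD2 hS2 hs2 r2 hv2 hξ2, pairE_add, Real.exp_add, Jint_prod]
    · ring
    · intro t t'
      have m1 : ∑ i, t i • v1 i ∈ Submodule.span ℝ c1 := by
        rw [← hv1.span]
        exact Submodule.sum_mem _ fun i _ => Submodule.smul_mem _ _ (Submodule.subset_span ⟨i, rfl⟩)
      have m2 : ∑ i, t' i • v2 i ∈ Submodule.span ℝ c2 := by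
        rw [← hv2.span]
        exact Submodule.sum_mem _ fun i _ => Submodule.smul_mem _ _ (Submodule.subset_span ⟨i, rfl⟩)
      constructor
      · rintro ⟨y1, hy1, y2, hy2, he⟩
        obtain ⟨e1, e2⟩ := h.inj (cone_span r1 hy1) (cone_span r2 hy2) (g1 m1) (g2 m2) he
        exact ⟨e1 ▸ hy1, e2 ▸ hy2⟩
      · rintro ⟨h1, h2⟩
        exact ⟨_, h1, _, h2, rfl⟩

lemma ql_zero (hQ : IsRatInner Λ Q) (Λ' : AddSubgroup (Vd d)) : ql Q Λ' {0} = Λ' := by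
  simp only [ql, span_zero_set, qp_bot hQ]
  ext; simp

lemma ql_rank_le (hQ : IsRatInner Λ Q) {Λ' : AddSubgroup (Vd d)}
    {c k : Set (Vd d)} (hc : IsRatCone Λ' c) (hk : CF c k) :
    Module.finrank ℝ (Submodule.span ℝ (ql Q Λ' k : Set (Vd d))) ≤
    Module.finrank ℝ (Submodule.span ℝ (Λ' : Set (Vd d))) := by
  by_cases h : k = {0}
  · rw [h, ql_zero hQ]
  · exact (ql_rank hQ hc hk h).le

lemma ql_sub (hQ : IsRatInner Λ Q) {Λ' : AddSubgroup (Vd d)}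
    {c k : Set (Vd d)} (hc : IsRatCone Λ' c) (hk : CF c k) :
    ∀ y ∈ Submodule.span ℝ (ql Q Λ' k : Set (Vd d)), y ∈ Submodule.span ℝ (Λ' : Set (Vd d)) := by
  intro y hy
  rw [ql, span_map] at hy
  obtain ⟨z, hz, rfl⟩ := hy
  exact qp_mem hQ (hk.span_le hc) hz

theorem mult (hΛ : IsFullLattice Λ) (hQ : IsRatInner Λ Q)
    (hI : IsIFamily Q Λ I) (hS : IsSFamily Q Λ S) (hμ : IsMuFamily Λ Q I S μ) (N : ℕ) :
    ∀ Λ1 Λ2 : AddSubgroup (Vd d),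
      Module.finrank ℝ (Submodule.span ℝ (Λ1 : Set (Vd d))) +
        Module.finrank ℝ (Submodule.span ℝ (Λ2 : Set (Vd d))) < N →
      IsQuotLattice Q Λ Λ1 → IsQuotLattice Q Λ Λ2 → IsQuotLattice Q Λ (Λ1 ⊔ Λ2) →
      (∀ x ∈ Submodule.span ℝ (Λ1 : Set (Vd d)), ∀ y ∈ Submodule.span ℝ (Λ2 : Set (Vd d)),
          Q x y = 0) →
      ∀ (s1 s2 : Vd d) (c1 c2 : Set (Vd d)), IsRatPoint Λ1 s1 → IsRatPoint Λ2 s2 →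
      IsRatCone Λ1 c1 → IsRatCone Λ2 c2 → (Uc c1).Nonempty → (Uc c2).Nonempty →
      MeroEqAt0 (μ (Λ1 ⊔ Λ2) (tr((s1 + s2),(c1 + c2))))
        (fun ξ => μ Λ1 (tr(s1,c1)) ξ * μ Λ2 (tr(s2,c2)) ξ) := by
  induction N with
  | zero => intro Λ1 Λ2 h; omega
  | succ N ih =>
    intro Λ1 Λ2 hN hq1 hq2 hq horth s1 s2 c1 c2 hs1 hs2 r1 r2 hU1 hU2
    have hD1 := disc_quot hΛ hQ hq1
    have hD2 := disc_quot hΛ hQ hq2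
    have hD := disc_quot hΛ hQ hq
    have h := exists_spl hQ horth
    have r := cone_sum (cone_mono (le_sup_left : Λ1 ≤ Λ1 ⊔ Λ2) r1) (cone_mono le_sup_right r2)
    have hs := ratPoint_add (ratPoint_mono (le_sup_left : Λ1 ≤ Λ1 ⊔ Λ2) hs1)
      (ratPoint_mono le_sup_right hs2)
    have g1 := cone_span r1
    have g2 := cone_span r2
    have hU := Uc_sum h g1 g2 hU1 hU2
    have hm1 := master hQ hμ hq1 hs1 r1 hU1
    have hm2 := master hQ hμ hq2 hs2 r2 hU2
    have hm := master hQ hμ hq hs r hU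
    have hSM := S_mult h hD1 hD2 hD (hS _ hq1) (hS _ hq2) (hS _ hq) hs1 hs2 r1 r2 hU
    have hIM : ∀ k1 k2, CF c1 k1 → CF c2 k2 →
        MeroEqAt0 (I (Λ1 ⊔ Λ2) (tr((s1 + s2),(k1 + k2))))
          (fun ξ => I Λ1 (tr(s1,k1)) ξ * I Λ2 (tr(s2,k2)) ξ) := fun k1 k2 h1 h2 =>
      I_mult h hD1 hD2 hD (hI _ hq1) (hI _ hq2) (hI _ hq) hs1 hs2 (h1.cone r1) (h2.cone r2)
        (hU.mono (Uc_mono (Set.add_subset_add h1.sub h2.sub)))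
    have hv1 := mt_vertex (μ := μ) (Λ' := Λ1) hQ s1 c1
    have hv2 := mt_vertex (μ := μ) (Λ' := Λ2) hQ s2 c2
    have hv := mt_vertex (μ := μ) (Λ' := Λ1 ⊔ Λ2) hQ (s1 + s2) (c1 + c2)
    rw [← hv1, ← hv2, ← hv]
    have key := meroEq_cancel ((CF_finite r1).toFinset ×ˢ (CF_finite r2).toFinset)
      (A := fun p => mt Q μ (Λ1 ⊔ Λ2) (s1 + s2) (c1 + c2) (p.1 + p.2))
      (B := fun p ξ => mt Q μ Λ1 s1 c1 p.1 ξ * mt Q μ Λ2 s2 c2 p.2 ξ)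
      (c := fun p ξ => I Λ1 (tr(s1,p.1)) ξ * I Λ2 (tr(s2,p.2)) ξ) ({0}, {0}) ?_ ?_ ?_ ?_
    · simpa using key
    · simpa using ⟨CF_vertex r1 hU1, CF_vertex r2 hU2⟩
    · have h1 : MeroEqAt0 (fun ξ => ∑ p ∈ (CF_finite r1).toFinset ×ˢ (CF_finite r2).toFinset,
          mt Q μ (Λ1 ⊔ Λ2) (s1 + s2) (c1 + c2) (p.1 + p.2) ξ *
            (I Λ1 (tr(s1,p.1)) ξ * I Λ2 (tr(s2,p.2)) ξ))
          (fun ξ => ∑ p ∈ (CF_finite r1).toFinset ×ˢ (CF_finite r2).toFinset,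
            mt Q μ (Λ1 ⊔ Λ2) (s1 + s2) (c1 + c2) (p.1 + p.2) ξ *
            I (Λ1 ⊔ Λ2) (tr((s1 + s2),(p.1 + p.2))) ξ) := by
        refine meroEq_sum _ fun p hp => ?_
        simp only [Finset.mem_product, Finite.mem_toFinset, mem_ofPred_eq] at hp
        exact meroEq_mul (meroEq_refl _) (meroEq_symm (hIM _ _ hp.1 hp.2))
      refine meroEq_trans h1 ?_
      have h2 : MeroEqAt0 (fun ξ => ∑ p ∈ (CF_finite r1).toFinset ×ˢ (CF_finite r2).toFinset,
            mt Q μ (Λ1 ⊔ Λ2) (s1 + s2) (c1 + c2) (p.1 + p.2) ξ *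
            I (Λ1 ⊔ Λ2) (tr((s1 + s2),(p.1 + p.2))) ξ)
          (S (Λ1 ⊔ Λ2) (tr((s1 + s2),(c1 + c2)))) := by
        refine meroEq_trans (meroEq_of_eq fun ξ => ?_) (meroEq_symm hm)
        exact (CF_finset_sum h g1 g2 r1 r2 r (fun k =>
          mt Q μ (Λ1 ⊔ Λ2) (s1 + s2) (c1 + c2) k ξ *
            I (Λ1 ⊔ Λ2) (tr((s1 + s2),k)) ξ)).symm
      refine meroEq_trans h2 (meroEq_trans hSM ?_)
      refine meroEq_trans (meroEq_mul hm1 hm2) (meroEq_of_eq fun ξ => ?_)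
      rw [Finset.sum_mul_sum, Finset.sum_product]
      exact Finset.sum_congr rfl fun k _ => Finset.sum_congr rfl fun l _ => by ring
    · rintro ⟨k1, k2⟩ hp hne
      simp only [Finset.mem_product, Finite.mem_toFinset, mem_ofPred_eq] at hp
      obtain ⟨hk1, hk2⟩ := hp
      obtain ⟨h1, h2, h3, h4⟩ := mt_hyp hQ hq1 hs1 r1 hk1
      obtain ⟨h1', h2', h3', h4'⟩ := mt_hyp hQ hq2 hs2 r2 hk2
      have hk := CF_sum_mk h g1 g2 hk1 hk2
      obtain ⟨h1s, -, -, -⟩ := mt_hyp hQ hq hs r hk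
      have hspan := span_add_set (hk1.zero r1) (hk2.zero r2)
      have hcomm : ∀ y1 ∈ Submodule.span ℝ (Λ1 : Set (Vd d)),
          ∀ y2 ∈ Submodule.span ℝ (Λ2 : Set (Vd d)),
          qp Q (Submodule.span ℝ (k1 + k2)) (y1 + y2) =
            qp Q (Submodule.span ℝ k1) y1 + qp Q (Submodule.span ℝ k2) y2 := by
        intro y1 hy1 y2 hy2
        have q1 := qp_mem hQ (hk1.span_le r1) hy1
        have q2 := qp_mem hQ (hk2.span_le r2) hy2
        refine coproj_unique hQ (qp_spec hQ _) ?_ ?_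
        · rw [hspan, add_sub_add_comm]
          exact Submodule.add_mem_sup ((qp_spec hQ _).1 y1) ((qp_spec hQ _).1 y2)
        · intro l hl
          rw [hspan] at hl
          obtain ⟨l1, hl1, l2, hl2, rfl⟩ := Submodule.mem_sup.1 hl
          have z1 := (qp_spec hQ (Submodule.span ℝ k1)).2 y1 l1 hl1
          have z2 := (qp_spec hQ (Submodule.span ℝ k2)).2 y2 l2 hl2
          have z3 := horth _ q1 _ (hk2.span_le r2 hl2)
          have z4 := horth _ (hk1.span_le r1 hl1) _ q2
          rw [hQ.1] at z4
          simp [z1, z2, z3, z4]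
      have hqls : ql Q (Λ1 ⊔ Λ2) (k1 + k2) = ql Q Λ1 k1 ⊔ ql Q Λ2 k2 := by
        ext z
        constructor
        · rintro ⟨y, hy, rfl⟩
          obtain ⟨l1, hl1, l2, hl2, rfl⟩ := AddSubgroup.mem_sup.1 hy
          refine AddSubgroup.mem_sup.2 ⟨_, ⟨l1, hl1, rfl⟩, _, ⟨l2, hl2, rfl⟩, ?_⟩
          exact (hcomm l1 (Submodule.subset_span hl1) l2 (Submodule.subset_span hl2)).symm
        · intro hz
          obtain ⟨_, ⟨l1, hl1, rfl⟩, _, ⟨l2, hl2, rfl⟩, rfl⟩ := AddSubgroup.mem_sup.1 hz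
          exact ⟨l1 + l2, AddSubgroup.add_mem_sup hl1 hl2,
            hcomm l1 (Submodule.subset_span hl1) l2 (Submodule.subset_span hl2)⟩
      have e1 := hcomm s1 (ratPoint_span hs1) s2 (ratPoint_span hs2)
      have e2 : qp Q (Submodule.span ℝ (k1 + k2)) '' (c1 + c2) =
          qp Q (Submodule.span ℝ k1) '' c1 + qp Q (Submodule.span ℝ k2) '' c2 := by
        ext z
        constructor
        · rintro ⟨_, ⟨y1, hy1, y2, hy2, rfl⟩, rfl⟩
          exact ⟨_, ⟨y1, hy1, rfl⟩, _, ⟨y2, hy2, rfl⟩, (hcomm y1 (g1 hy1) y2 (g2 hy2)).symm⟩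
        · rintro ⟨_, ⟨y1, hy1, rfl⟩, _, ⟨y2, hy2, rfl⟩, rfl⟩
          exact ⟨_, ⟨y1, hy1, y2, hy2, rfl⟩, hcomm y1 (g1 hy1) y2 (g2 hy2)⟩
      have hrank : Module.finrank ℝ (Submodule.span ℝ (ql Q Λ1 k1 : Set (Vd d))) +
          Module.finrank ℝ (Submodule.span ℝ (ql Q Λ2 k2 : Set (Vd d))) < N := by
        have l1 := ql_rank_le hQ r1 hk1
        have l2 := ql_rank_le hQ r2 hk2
        by_cases z1 : k1 = {0}
        · have z2 : k2 ≠ {0} := fun z2 => hne (by rw [z1, z2])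
          have := ql_rank hQ r2 hk2 z2
          omega
        · have := ql_rank hQ r1 hk1 z1
          omega
      rw [hqls] at h1s
      have := ih (ql Q Λ1 k1) (ql Q Λ2 k2) hrank h1 h1' h1s
        (fun a ha b hb => horth a (ql_sub hQ r1 hk1 a ha) b (ql_sub hQ r2 hk2 b hb))
        _ _ _ _ h2 h2' h3 h3' h4 h4'
      simp only [mt, e1, e2, hqls]
      exact this
    · intro ξ
      simp only
      rw [I_vertex hD1 (hI Λ1 hq1) hs1, I_vertex hD2 (hI Λ2 hq2) hs2]
      positivity

end mult

end MuAux

namespace MuAux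

section final
variable {d : ℕ} {Λ : AddSubgroup (Vd d)} {Q : Vd d →ₗ[ℝ] Vd d →ₗ[ℝ] ℝ}
  {I S μ : AddSubgroup (Vd d) → Set (Vd d) → Vd d → ℝ}

lemma part_ab (hΛ : IsFullLattice Λ) (hQ : IsRatInner Λ Q)
    (hI : IsIFamily Q Λ I) (hS : IsSFamily Q Λ S) (hμ : IsMuFamily Λ Q I S μ)
    {Λ' : AddSubgroup (Vd d)} (hq : IsQuotLattice Q Λ Λ') {a : Set (Vd d)}
    (ha : IsRatAffineCone Λ' a) (g σ : Vd d ≃ₗ[ℝ] Vd d)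
    (hiso : ∀ x ∈ Submodule.span ℝ (Λ' : Set (Vd d)), ∀ y ∈ Submodule.span ℝ (Λ' : Set (Vd d)),
          Q (g x) (g y) = Q x y)
    (hmap : AddSubgroup.map g.toLinearMap.toAddMonoidHom Λ' = Λ')
    (hσ : ∀ ξ x : Vd d, pairE (σ ξ) (g x) = pairE ξ x) {x : Vd d} (hx : x ∈ Λ') :
    MeroEqAt0 (fun ξ => μ Λ' ((fun y => x + g y) '' a) (σ ξ)) (μ Λ' a) := by
  have ha' := ha
  obtain ⟨s, c, hs, hc, rfl⟩ := affCone_iff.1 ha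
  have e : (fun y => x + g y) '' ((fun y => s + y) '' c) = (fun y => (x + g s) + y) '' (g '' c) := by
    rw [image_image, image_image]
    refine image_congr fun y _ => ?_
    rw [map_add, add_assoc]
  by_cases hl : ContainsLine ((fun y => s + y) '' c)
  · refine meroEq_of_eq fun ξ => ?_
    rw [hμ.2 Λ' hq _ ha' hl, hμ.2 Λ' hq]
    · rw [e]
      refine affCone_iff.2 ⟨_, _, ?_, ?_, rfl⟩
      · refine ratPoint_add (ratPoint_of_mem hx) ?_
        have := ratPoint_map hs (g : Vd d →ₗ[ℝ] Vd d)
        rw [hmap] at this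
        exact this
      · have := cone_map hc (g : Vd d →ₗ[ℝ] Vd d)
        rw [hmap] at this
        exact this
    · obtain ⟨p, u, hu, hline⟩ := hl
      refine ⟨x + g p, g u, by simpa using hu, fun t => ⟨_, hline t, ?_⟩⟩
      simp only [map_add, map_smul, add_assoc]
  · have hU := Uc_nonempty hc s hl
    rw [e]
    exact transform hΛ hQ hI hS hμ g σ hσ _ Λ' Λ' (Nat.lt_succ_self _) hq hq hiso hmap x s c hx hs
      hc hU

lemma quot_summand (hQ : IsRatInner Λ Q) {Λ' Λ1 Λ2 : AddSubgroup (Vd d)}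
    (hq : IsQuotLattice Q Λ Λ') (hsup : Λ' = Λ1 ⊔ Λ2)
    (horth : ∀ x ∈ Submodule.span ℝ (Λ1 : Set (Vd d)), ∀ y ∈ Submodule.span ℝ (Λ2 : Set (Vd d)),
          Q x y = 0) : IsQuotLattice Q Λ Λ1 := by
  have hspl := exists_spl hQ horth
  have h2 : Λ2 ≤ Λ' := hsup ▸ le_sup_right
  have h1 : Λ1 ≤ Λ' := hsup ▸ le_sup_left
  have := quot_quot hQ hq (Submodule.span ℝ (Λ2 : Set (Vd d))) ?_ (qp_spec hQ _)
  · convert this using 1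
    ext z
    constructor
    · intro hz
      exact ⟨z, h1 hz, hspl.a1 z (Submodule.subset_span hz)⟩
    · rintro ⟨y, hy, rfl⟩
      have hy' : y ∈ Λ1 ⊔ Λ2 := hsup ▸ hy
      obtain ⟨l1, hl1, l2, hl2, rfl⟩ := AddSubgroup.mem_sup.1 hy'
      have := hspl.fst (Submodule.subset_span hl1) (Submodule.subset_span hl2)
      change qp Q _ (l1 + l2) ∈ Λ1
      rw [this]
      exact hl1
  · apply le_antisymm
    · exact Submodule.span_le.2 fun x hx => hx.1
    · exact Submodule.span_mono fun x hx => ⟨Submodule.subset_span hx, h2 hx⟩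

lemma part_c (hΛ : IsFullLattice Λ) (hQ : IsRatInner Λ Q)
    (hI : IsIFamily Q Λ I) (hS : IsSFamily Q Λ S) (hμ : IsMuFamily Λ Q I S μ)
    {Λ' Λ1 Λ2 : AddSubgroup (Vd d)} (hq : IsQuotLattice Q Λ Λ') (hsup : Λ' = Λ1 ⊔ Λ2)
    (horth : ∀ x ∈ Submodule.span ℝ (Λ1 : Set (Vd d)), ∀ y ∈ Submodule.span ℝ (Λ2 : Set (Vd d)),
          Q x y = 0) {a₁ a₂ : Set (Vd d)}
    (ha1 : IsRatAffineCone Λ1 a₁) (ha2 : IsRatAffineCone Λ2 a₂) :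
    MeroEqAt0 (μ Λ' (a₁ + a₂)) (fun ξ => μ Λ1 a₁ ξ * μ Λ2 a₂ ξ) := by
  have hq1 := quot_summand hQ hq hsup horth
  have hq2 : IsQuotLattice Q Λ Λ2 := quot_summand hQ hq (by rw [hsup, sup_comm])
    (fun x hx y hy => by rw [hQ.1]; exact horth y hy x hx)
  have ha1' := ha1
  have ha2' := ha2
  obtain ⟨s1, c1, hs1, r1, rfl⟩ := affCone_iff.1 ha1
  obtain ⟨s2, c2, hs2, r2, rfl⟩ := affCone_iff.1 ha2
  have hrat : IsRatAffineCone Λ' ((fun y => s1 + y) '' c1 + (fun y => s2 + y) '' c2) := by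
    rw [affSum_eq, hsup]
    exact affCone_iff.2 ⟨_, _, ratPoint_add (ratPoint_mono le_sup_left hs1)
      (ratPoint_mono le_sup_right hs2), cone_sum (cone_mono le_sup_left r1)
      (cone_mono le_sup_right r2), rfl⟩
  by_cases hl1 : ContainsLine ((fun y => s1 + y) '' c1)
  · refine meroEq_of_eq fun ξ => ?_
    rw [hμ.2 Λ1 hq1 _ ha1' hl1, zero_mul, hμ.2 Λ' hq _ hrat]
    obtain ⟨p, u, hu, hline⟩ := hl1
    exact ⟨p + (s2 + 0), u, hu, fun t => ⟨_, hline t, _, ⟨0, cone_zero r2, rfl⟩, by simp only; abel⟩⟩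
  by_cases hl2 : ContainsLine ((fun y => s2 + y) '' c2)
  · refine meroEq_of_eq fun ξ => ?_
    rw [hμ.2 Λ2 hq2 _ ha2' hl2, mul_zero, hμ.2 Λ' hq _ hrat]
    obtain ⟨p, u, hu, hline⟩ := hl2
    exact ⟨(s1 + 0) + p, u, hu, fun t => ⟨_, ⟨0, cone_zero r1, rfl⟩, _, hline t, by simp only; abel⟩⟩
  subst hsup
  rw [affSum_eq]
  exact mult hΛ hQ hI hS hμ _ Λ1 Λ2 (Nat.lt_succ_self _) hq1 hq2 hq horth s1 s2 c1 c2 hs1 hs2 r1 r2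
    (Uc_nonempty r1 s1 hl1) (Uc_nonempty r2 s2 hl2)

end final

end MuAux

/-- the functions `μ` are (a) invariant under translation by lattice points,
(b) equivariant under lattice-preserving linear isometries (`μ(g(a))(ᵗg⁻¹ξ) = μ(a)(ξ)`),
(c) multiplicative for `Q`-orthogonal direct sums, and (d) vanish on pointed cones whose
affine span contains no lattice point. -/
theorem statement8 (d : ℕ) (Λ : AddSubgroup (Vd d)) (hΛ : IsFullLattice Λ)
    (Q : Vd d →ₗ[ℝ] Vd d →ₗ[ℝ] ℝ) (hQ : IsRatInner Λ Q)
    (I S μ : AddSubgroup (Vd d) → Set (Vd d) → Vd d → ℝ)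
    (hI : IsIFamily Q Λ I) (hS : IsSFamily Q Λ S) (hμ : IsMuFamily Λ Q I S μ) :
    -- (a) invariance under lattice translations
    (∀ Λ', IsQuotLattice Q Λ Λ' → ∀ a, IsRatAffineCone Λ' a → ∀ x ∈ Λ',
      MeroEqAt0 (μ Λ' ((fun y => x + y) '' a)) (μ Λ' a)) ∧
    -- (b) equivariance under lattice-preserving linear isometries
    (∀ Λ', IsQuotLattice Q Λ Λ' → ∀ a, IsRatAffineCone Λ' a →
      ∀ g : Vd d ≃ₗ[ℝ] Vd d,
        (∀ x ∈ Submodule.span ℝ (Λ' : Set (Vd d)), ∀ y ∈ Submodule.span ℝ (Λ' : Set (Vd d)),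
          Q (g x) (g y) = Q x y) →
        AddSubgroup.map g.toLinearMap.toAddMonoidHom Λ' = Λ' →
        ∀ σ : Vd d ≃ₗ[ℝ] Vd d, (∀ ξ x : Vd d, pairE (σ ξ) (g x) = pairE ξ x) →
          MeroEqAt0 (fun ξ => μ Λ' (⇑g '' a) (σ ξ)) (μ Λ' a)) ∧
    -- (c) multiplicativity for orthogonal sums
    (∀ Λ', IsQuotLattice Q Λ Λ' → ∀ W₁ W₂ : Submodule ℝ (Vd d),
      (∀ x ∈ W₁, ∀ y ∈ W₂, Q x y = 0) →
      Submodule.span ℝ (Λ' : Set (Vd d)) = W₁ ⊔ W₂ →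
      (∀ x ∈ Λ', ∃ y ∈ Λ', ∃ z ∈ Λ', (y : Vd d) ∈ W₁ ∧ (z : Vd d) ∈ W₂ ∧ x = y + z) →
      ∀ a₁ a₂ : Set (Vd d),
        IsRatAffineCone (Λ' ⊓ W₁.toAddSubgroup) a₁ →
        IsRatAffineCone (Λ' ⊓ W₂.toAddSubgroup) a₂ →
        MeroEqAt0 (μ Λ' (a₁ + a₂))
          (fun ξ => μ (Λ' ⊓ W₁.toAddSubgroup) a₁ ξ * μ (Λ' ⊓ W₂.toAddSubgroup) a₂ ξ)) ∧
    -- (d) vanishing when the affine span misses the lattice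
    (∀ Λ', IsQuotLattice Q Λ Λ' → ∀ a, IsRatAffineCone Λ' a → ¬ ContainsLine a →
      ((affineSpan ℝ a : AffineSubspace ℝ (Vd d)) : Set (Vd d)) ∩ (Λ' : Set (Vd d)) = ∅ →
      MeroEqAt0 (μ Λ' a) (fun _ => 0)) := by
  refine ⟨?_, ?_, ?_, ?_⟩
  · intro Λ' hq a ha x hx
    exact MuAux.part_ab hΛ hQ hI hS hμ hq ha (LinearEquiv.refl ℝ _) (LinearEquiv.refl ℝ _)
      (fun _ _ _ _ => rfl) (by ext; simp) (fun _ _ => rfl) hx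
  · intro Λ' hq a ha g hiso hmap σ hσ
    have h := MuAux.part_ab hΛ hQ hI hS hμ hq ha g σ hiso hmap hσ (zero_mem Λ')
    have e : (fun y => 0 + g y) '' a = ⇑g '' a := by simp
    rw [e] at h
    exact h
  · intro Λ' hq W₁ W₂ horth hspan hsplit a₁ a₂ ha1 ha2
    have hle : ∀ W : Submodule ℝ (Vd d),
        Submodule.span ℝ ((Λ' ⊓ W.toAddSubgroup : AddSubgroup (Vd d)) : Set (Vd d)) ≤ W :=
      fun W => Submodule.span_le.2 fun x hx => hx.2
    refine MuAux.part_c hΛ hQ hI hS hμ hq ?_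
      (fun x hx y hy => horth x (hle W₁ hx) y (hle W₂ hy)) ha1 ha2
    apply le_antisymm
    · intro x hx
      obtain ⟨y, hy, z, hz, hy1, hz2, rfl⟩ := hsplit x hx
      exact AddSubgroup.add_mem_sup ⟨hy, hy1⟩ ⟨hz, hz2⟩
    · exact sup_le inf_le_left inf_le_left
  · intro Λ' hq a ha hl hemp
    obtain ⟨s, c, hs, hc, rfl⟩ := MuAux.affCone_iff.1 ha
    refine MuAux.vanish hΛ hQ hI hS hμ _ Λ' (Nat.lt_succ_self _) hq s c hs hc
      (MuAux.Uc_nonempty hc s hl) fun x hx hmem => ?_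
    have : x ∈ ((affineSpan ℝ ((fun y => s + y) '' c) : AffineSubspace ℝ (Vd d)) : Set (Vd d)) ∩
        (Λ' : Set (Vd d)) := ⟨(MuAux.affine_coe (MuAux.cone_zero hc) x).2 hmem, hx⟩
    rw [hemp] at this
    exact this
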